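/- arXiv:1807.03926 — 4 statements merged into one kernel-verified Lean document; each statement's English description precedes it below -/
import Mathlib

section
/- Let t > 0 and let (k(n)) be an increasing sequence of positive integers with (n − k(n))/√n → t as n → ∞. For each n write k = k(n) and r = n − k, let C = (C_1, C_2, ...) be the cycle-length counts of a uniformly random permutation of {1,...,n} with exactly k cycles, and let Z_1 be a Poisson random variable with mean (4/3)·r²/n. Then there exist a constant K > 0 and N such that for all n ≥ N, d_TV( C , (2k − n + Z_1, r − 2Z_1, Z_1, 0, 0, ...) ) ≤ K · exp((2/3)·r²/n) · r³/n²; in particular the total variation distance is O(exp((2/3)(n−k)²/n) · (n−k)³/n²). -/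
open Finset Filter

/-- The number of cycles of a permutation, counting fixed points as cycles of length one. -/
def numCycles {n : ℕ} (σ : Equiv.Perm (Fin n)) : ℕ :=
  σ.cycleType.card + (Finset.univ.filter fun x => σ x = x).card

/-- `C_i`, the number of cycles of length `i` of a permutation (fixed points are the cycles
of length one). -/
def cycleCount {n : ℕ} (σ : Equiv.Perm (Fin n)) (i : ℕ) : ℕ :=
  if i = 1 then (Finset.univ.filter fun x => σ x = x).card
  else Multiset.count i σ.cycleType

/-- Probability of event `E` for a uniformly random permutation of `{1,…,n}` with exactly
`k` cycles. -/
noncomputable def permProb (n k : ℕ) (E : Equiv.Perm (Fin n) → Prop) : ℝ :=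
  (Nat.card {σ : Equiv.Perm (Fin n) // numCycles σ = k ∧ E σ} : ℝ) /
    (Nat.card {σ : Equiv.Perm (Fin n) // numCycles σ = k} : ℝ)

/-- The permutations of `{1,…,n}` with exactly `n - r` cycles, fixed points included. -/
def permsOfDefect (n r : ℕ) : Finset (Equiv.Perm (Fin n)) :=
  univ.filter fun σ => σ.cycleType.sum = σ.cycleType.card + r

theorem mem_permsOfDefect {n r : ℕ} {σ : Equiv.Perm (Fin n)} :
    σ ∈ permsOfDefect n r ↔ σ.cycleType.sum = σ.cycleType.card + r := by
  simp [permsOfDefect]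

theorem card_fixed_add_card_support {n : ℕ} (σ : Equiv.Perm (Fin n)) :
    (univ.filter fun x => σ x = x).card + σ.support.card = n := by
  have h := Finset.card_filter_add_card_filter_not (s := (univ : Finset (Fin n)))
    (fun x => σ x = x)
  simpa [Equiv.Perm.support] using h

theorem numCycles_eq_iff {n k r : ℕ} (h : k + r = n) (σ : Equiv.Perm (Fin n)) :
    numCycles σ = k ↔ σ ∈ permsOfDefect n r := by
  have h1 := card_fixed_add_card_support σ
  have h2 := σ.sum_cycleType
  rw [mem_permsOfDefect, numCycles]
  omega

theorem two_mul_card_cycleType_le {n : ℕ} (σ : Equiv.Perm (Fin n)) :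
    2 * σ.cycleType.card ≤ σ.cycleType.sum := by
  have := Multiset.card_nsmul_le_sum (s := σ.cycleType) (a := 2)
    (fun x hx => Equiv.Perm.two_le_of_mem_cycleType hx)
  simpa [mul_comm] using this

theorem card_support_le_of_mem_permsOfDefect {n r : ℕ} {σ : Equiv.Perm (Fin n)}
    (hσ : σ ∈ permsOfDefect n r) : σ.support.card ≤ 2 * r := by
  have h1 := two_mul_card_cycleType_le σ
  have h2 := σ.sum_cycleType
  rw [mem_permsOfDefect] at hσ
  omega

/-- Multiplying by a transposition of two fixed points lowers the number of cycles by one. -/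
theorem mul_swap_mem_permsOfDefect {n r : ℕ} {σ : Equiv.Perm (Fin n)}
    (hσ : σ ∈ permsOfDefect n r) {a b : Fin n} (ha : σ a = a) (hb : σ b = b) (hab : a ≠ b) :
    σ * Equiv.swap a b ∈ permsOfDefect n (r + 1) := by
  have hd : σ.Disjoint (Equiv.swap a b) := by
    rw [Equiv.Perm.disjoint_iff_disjoint_support, Equiv.Perm.support_swap hab]
    simp [ha, hb]
  rw [mem_permsOfDefect] at hσ ⊢
  rw [hd.cycleType_mul, (Equiv.Perm.swap_isSwap_iff.2 hab).isCycle.cycleType,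
    Equiv.Perm.card_support_swap hab]
  simp
  omega

theorem card_permsOfDefect_mul_le (n r : ℕ) :
    (permsOfDefect n r).card * ((n - 2 * r) * (n - 2 * r - 1)) ≤
      (permsOfDefect n (r + 1)).card * (2 * (r + 1)) := by
  let P := (permsOfDefect n r).sigma fun σ => (univ.filter fun x => σ x = x).offDiag
  let Q := (permsOfDefect n (r + 1)).sigma fun σ => σ.support
  have hPQ : P.card ≤ Q.card := by
    refine Finset.card_le_card_of_injOn (fun p => ⟨p.1 * Equiv.swap p.2.1 p.2.2, p.2.1⟩) ?_ ?_
    · rintro ⟨σ, a, b⟩ h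
      simp only [P, Q, Finset.coe_sigma, Set.mem_sigma_iff, Finset.mem_coe, mem_offDiag,
        mem_filter, mem_univ, true_and] at h ⊢
      obtain ⟨hσ, ha, hb, hab⟩ := h
      refine ⟨mul_swap_mem_permsOfDefect hσ ha hb hab, ?_⟩
      simp [hb, hab.symm]
    · rintro ⟨σ, a, b⟩ h ⟨σ', a', b'⟩ h' heq
      simp only [P, Finset.coe_sigma, Set.mem_sigma_iff, Finset.mem_coe, mem_offDiag,
        mem_filter, mem_univ, true_and] at h h'
      simp only [Sigma.mk.injEq, heq_eq_eq] at heq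
      obtain ⟨h1, rfl⟩ := heq
      have hb : b = b' := by
        have := congrArg (fun f : Equiv.Perm (Fin n) => f a) h1
        simpa [h.2.2.1, h'.2.2.1] using this
      subst hb
      simpa using h1
  have hP : (permsOfDefect n r).card * ((n - 2 * r) * (n - 2 * r - 1)) ≤ P.card := by
    rw [Finset.card_sigma, ← smul_eq_mul]
    refine Finset.card_nsmul_le_sum _ _ _ fun σ hσ => ?_
    have h1 := card_fixed_add_card_support σ
    have h2 := card_support_le_of_mem_permsOfDefect hσ
    rw [Finset.offDiag_card, ← Nat.mul_sub_one]
    exact Nat.mul_le_mul (by omega) (by omega)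
  have hQ : Q.card ≤ (permsOfDefect n (r + 1)).card * (2 * (r + 1)) := by
    rw [Finset.card_sigma, ← smul_eq_mul]
    exact Finset.sum_le_card_nsmul _ _ _ fun σ hσ => card_support_le_of_mem_permsOfDefect hσ
  exact hP.trans (hPQ.trans hQ)

theorem card_cycleType_singleton_le (n m : ℕ) (hm : 2 ≤ m) :
    (univ.filter fun σ : Equiv.Perm (Fin n) => σ.cycleType = {m}).card ≤ n ^ m := by
  by_cases hmn : m ≤ n
  · rw [Equiv.Perm.card_of_cycleType_singleton hm (by simpa using hmn), Fintype.card_fin]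
    calc (m - 1).factorial * n.choose m ≤ m.factorial * n.choose m :=
          Nat.mul_le_mul_right _ (Nat.factorial_le (by omega))
      _ = n.descFactorial m := (Nat.descFactorial_eq_factorial_mul_choose n m).symm
      _ ≤ n ^ m := Nat.descFactorial_le_pow n m
  · rw [Finset.card_eq_zero.2]
    · exact Nat.zero_le _
    · refine Finset.filter_eq_empty_iff.2 fun σ _ h => hmn ?_
      have h1 := σ.sum_cycleType
      have h2 := Finset.card_le_univ σ.support
      rw [h, Multiset.sum_singleton] at h1
      rw [Fintype.card_fin] at h2
      omega

/-- Permutations having a cycle longer than three are rare: removing such a cycle, of length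
`m = j + 1`, leaves a permutation with defect `r - j`. -/
theorem card_permsOfDefect_exists_long_le (n r : ℕ) :
    ((permsOfDefect n r).filter fun σ => ¬∀ m ∈ σ.cycleType, m ≤ 3).card ≤
      ∑ j ∈ Finset.Icc 3 r, n ^ (j + 1) * (permsOfDefect n (r - j)).card := by
  classical
  let F : ℕ → Finset (Equiv.Perm (Fin n)) := fun j =>
    ((univ.filter fun σ : Equiv.Perm (Fin n) => σ.cycleType = {j + 1}) ×ˢ
      permsOfDefect n (r - j)).image fun p => p.1 * p.2
  have hsub : ((permsOfDefect n r).filter fun σ => ¬∀ m ∈ σ.cycleType, m ≤ 3) ⊆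
      (Finset.Icc 3 r).biUnion F := by
    intro σ hσ
    obtain ⟨hσ, hlong⟩ := Finset.mem_filter.1 hσ
    push Not at hlong
    obtain ⟨m, hm, hm4⟩ := hlong
    obtain ⟨c, τ, rfl, hd, hc, hcard⟩ := Equiv.Perm.mem_cycleType_iff.1 hm
    have hct : c.cycleType = {m} := by rw [hc.cycleType, hcard]
    have h1 := two_mul_card_cycleType_le τ
    rw [mem_permsOfDefect, hd.cycleType_mul, hct] at hσ
    simp only [Multiset.sum_add, Multiset.sum_singleton, Multiset.card_add,
      Multiset.card_singleton] at hσ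
    refine Finset.mem_biUnion.2 ⟨m - 1, Finset.mem_Icc.2 (by omega), Finset.mem_image.2
      ⟨(c, τ), Finset.mem_product.2 ⟨?_, ?_⟩, rfl⟩⟩
    · simpa [hct] using (by omega : m = m - 1 + 1)
    · rw [mem_permsOfDefect]
      dsimp only
      omega
  refine (Finset.card_le_card hsub).trans (Finset.card_biUnion_le.trans
    (Finset.sum_le_sum fun j hj => Finset.card_image_le.trans ?_))
  rw [Finset.card_product]
  exact Nat.mul_le_mul_right _
    (card_cycleType_singleton_le n (j + 1) (by have := (Finset.mem_Icc.1 hj).1; omega))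

theorem card_permsOfDefect_sub_le {n r : ℕ} (hr : 1 ≤ r) (hn : 12 * r ≤ n) (j : ℕ) (hj : j ≤ r) :
    ((permsOfDefect n (r - j)).card : ℝ) ≤
      (6 * r / (n : ℝ) ^ 2) ^ j * (permsOfDefect n r).card := by
  have hr' : (1 : ℝ) ≤ r := by exact_mod_cast hr
  have hn' : (12 : ℝ) * r ≤ n := by exact_mod_cast hn
  have hn0 : (0 : ℝ) < n := by linarith
  induction j with
  | zero => simp
  | succ j ih =>
    have ih := ih (by omega)
    have hstep := card_permsOfDefect_mul_le n (r - (j + 1))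
    rw [show r - (j + 1) + 1 = r - j by omega] at hstep
    have hstep' : ((permsOfDefect n (r - (j + 1))).card : ℝ) * ((n : ℝ) ^ 2 / 3) ≤
        (permsOfDefect n (r - j)).card * (2 * r) := by
      have h3 : n * n ≤ 3 * ((n - 2 * (r - (j + 1))) * (n - 2 * (r - (j + 1)) - 1)) := by
        obtain ⟨q, hq⟩ : ∃ q, n - 2 * (r - (j + 1)) = q + 1 := ⟨n - 2 * (r - (j + 1)) - 1, by omega⟩
        rw [hq, Nat.add_sub_cancel]
        have : 5 * n ≤ 6 * (q + 1) := by omega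
        have : 12 ≤ n := by omega
        nlinarith
      have h4 : (permsOfDefect n (r - (j + 1))).card * (n * n) ≤
          (permsOfDefect n (r - j)).card * (6 * r) := by
        calc _ ≤ (permsOfDefect n (r - (j + 1))).card *
              (3 * ((n - 2 * (r - (j + 1))) * (n - 2 * (r - (j + 1)) - 1))) :=
              Nat.mul_le_mul_left _ h3
          _ = 3 * ((permsOfDefect n (r - (j + 1))).card *
              ((n - 2 * (r - (j + 1))) * (n - 2 * (r - (j + 1)) - 1))) := by ring
          _ ≤ 3 * ((permsOfDefect n (r - j)).card * (2 * (r - j))) := Nat.mul_le_mul_left _ hstep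
          _ = (permsOfDefect n (r - j)).card * (6 * (r - j)) := by ring
          _ ≤ _ := Nat.mul_le_mul_left _ (by omega)
      have h5 : ((permsOfDefect n (r - (j + 1))).card : ℝ) * (n * n) ≤
          (permsOfDefect n (r - j)).card * (6 * r) := by exact_mod_cast h4
      nlinarith
    have h6 : ((permsOfDefect n (r - (j + 1))).card : ℝ) ≤
        6 * r / (n : ℝ) ^ 2 * (permsOfDefect n (r - j)).card := by
      rw [div_mul_eq_mul_div, le_div_iff₀ (by positivity)]
      nlinarith
    calc _ ≤ _ := h6
      _ ≤ 6 * r / (n : ℝ) ^ 2 * ((6 * r / (n : ℝ) ^ 2) ^ j * (permsOfDefect n r).card) := by gcongr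
      _ = _ := by ring

theorem card_permsOfDefect_exists_long_le_mul {n r : ℕ} (hr : 1 ≤ r) (hn : 12 * r ≤ n) :
    (((permsOfDefect n r).filter fun σ => ¬∀ m ∈ σ.cycleType, m ≤ 3).card : ℝ) ≤
      432 * ((r : ℝ) ^ 3 / (n : ℝ) ^ 2) * (permsOfDefect n r).card := by
  have hr' : (1 : ℝ) ≤ r := by exact_mod_cast hr
  have hn' : (12 : ℝ) * r ≤ n := by exact_mod_cast hn
  have hn0 : (0 : ℝ) < n := by linarith
  have h := card_permsOfDefect_exists_long_le n r
  set x : ℝ := 6 * r / n with hx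
  have hx0 : 0 ≤ x := by positivity
  have hx2 : x ≤ 1 / 2 := by rw [hx, div_le_iff₀ hn0]; linarith
  calc (((permsOfDefect n r).filter fun σ => ¬∀ m ∈ σ.cycleType, m ≤ 3).card : ℝ)
      ≤ ∑ j ∈ Finset.Icc 3 r, (n : ℝ) ^ (j + 1) * (permsOfDefect n (r - j)).card := by
        exact_mod_cast h
    _ ≤ ∑ j ∈ Finset.Icc 3 r, x ^ j * (n * (permsOfDefect n r).card) := by
        refine Finset.sum_le_sum fun j hj => ?_
        calc _ ≤ (n : ℝ) ^ (j + 1) * ((6 * r / (n : ℝ) ^ 2) ^ j * (permsOfDefect n r).card) := by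
              gcongr
              exact card_permsOfDefect_sub_le hr hn j (Finset.mem_Icc.1 hj).2
          _ = ((n : ℝ) * (6 * r / (n : ℝ) ^ 2)) ^ j * (n * (permsOfDefect n r).card) := by
              rw [mul_pow]; ring
          _ = _ := by
              congr 2
              rw [hx]; field_simp
    _ = (∑ j ∈ Finset.Icc 3 r, x ^ j) * (n * (permsOfDefect n r).card) := by
        rw [Finset.sum_mul]
    _ ≤ (2 * x ^ 3) * (n * (permsOfDefect n r).card) := by
        gcongr
        have h1 : ∑ j ∈ Finset.Ico 3 (r + 1), x ^ j ≤ x ^ 3 / (1 - x) :=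
          geom_sum_Ico_le_of_lt_one hx0 (by linarith)
        refine h1.trans ?_
        rw [div_le_iff₀ (by linarith)]
        nlinarith [pow_nonneg hx0 3]
    _ = _ := by rw [hx]; field_simp; ring

/-- The permutations of defect `r` whose cycles have length at most three, exactly `z` of them
being of length three. -/
def shortPerms (n r z : ℕ) : Finset (Equiv.Perm (Fin n)) :=
  (permsOfDefect n r).filter fun σ => (∀ m ∈ σ.cycleType, m ≤ 3) ∧ σ.cycleType.count 3 = z

theorem Multiset.eq_replicate_two_add_replicate_three {s : Multiset ℕ}
    (h2 : ∀ m ∈ s, 2 ≤ m) (h3 : ∀ m ∈ s, m ≤ 3) :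
    s = Multiset.replicate (s.count 2) 2 + Multiset.replicate (s.count 3) 3 := by
  ext i
  rw [Multiset.count_add, Multiset.count_replicate, Multiset.count_replicate]
  by_cases hi : i ∈ s
  · have := h2 i hi
    have := h3 i hi
    interval_cases i <;> simp
  · have : Multiset.count i s = 0 := Multiset.count_eq_zero.2 hi
    split_ifs <;> simp_all

theorem mem_shortPerms_iff {n r z : ℕ} {σ : Equiv.Perm (Fin n)} :
    σ ∈ shortPerms n r z ↔ 2 * z ≤ r ∧
      σ.cycleType = Multiset.replicate (r - 2 * z) 2 + Multiset.replicate z 3 := by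
  rw [shortPerms, Finset.mem_filter, mem_permsOfDefect]
  constructor
  · rintro ⟨hσ, h3, rfl⟩
    have h := Multiset.eq_replicate_two_add_replicate_three
      (fun m hm => Equiv.Perm.two_le_of_mem_cycleType hm) h3
    have hs := congrArg Multiset.sum h
    have hc := congrArg Multiset.card h
    simp only [Multiset.sum_add, Multiset.sum_replicate, Multiset.card_add,
      Multiset.card_replicate, smul_eq_mul] at hs hc
    have h2 : σ.cycleType.count 2 = r - 2 * σ.cycleType.count 3 := by omega
    exact ⟨by omega, by rw [← h2]; exact h⟩
  · rintro ⟨hz, h⟩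
    rw [h]
    refine ⟨?_, ?_, ?_⟩
    · simp only [Multiset.sum_add, Multiset.sum_replicate, Multiset.card_add,
        Multiset.card_replicate, smul_eq_mul]
      omega
    · intro m hm
      rcases Multiset.mem_add.1 hm with hm | hm <;> have := Multiset.eq_of_mem_replicate hm <;> omega
    · simp [Multiset.count_replicate]

theorem shortPerms_eq_empty {n r z : ℕ} (h : r < 2 * z) : shortPerms n r z = ∅ :=
  Finset.eq_empty_of_forall_notMem fun _ hσ => by
    have := (mem_shortPerms_iff.1 hσ).1
    omega

theorem card_shortPerms_mul {n r z : ℕ} (hz : 2 * z ≤ r) (hn : 2 * r ≤ n) :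
    (shortPerms n r z).card * ((n - 2 * r + z).factorial * (2 ^ (r - 2 * z) * 3 ^ z) *
      ((r - 2 * z).factorial * z.factorial)) = n.factorial := by
  set m := Multiset.replicate (r - 2 * z) 2 + Multiset.replicate z 3 with hm
  have hs : shortPerms n r z = univ.filter fun σ : Equiv.Perm (Fin n) => σ.cycleType = m := by
    ext σ
    simp [mem_shortPerms_iff, hz, hm]
  have hsum : m.sum = 2 * r - z := by
    simp only [hm, Multiset.sum_add, Multiset.sum_replicate, smul_eq_mul]
    omega
  have hprod : ∏ i ∈ m.toFinset, (m.count i).factorial =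
      (r - 2 * z).factorial * z.factorial := by
    have hsub : m.toFinset ⊆ {2, 3} := by
      intro i hi
      rcases Multiset.mem_add.1 (Multiset.mem_toFinset.1 hi) with h | h <;>
        simp [Multiset.eq_of_mem_replicate h]
    rw [Finset.prod_subset hsub, Finset.prod_pair (by norm_num)]
    · simp [hm, Multiset.count_replicate]
    · intro i _ hi
      rw [Multiset.count_eq_zero.2 fun h => hi (Multiset.mem_toFinset.2 h), Nat.factorial_zero]
  have h := Equiv.Perm.card_of_cycleType_mul_eq (Fin n) m
  have hcond : m.sum ≤ Fintype.card (Fin n) ∧ ∀ a ∈ m, 2 ≤ a := by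
    refine ⟨by rw [hsum, Fintype.card_fin]; omega, fun a ha => ?_⟩
    rcases Multiset.mem_add.1 ha with h | h <;> have := Multiset.eq_of_mem_replicate h <;> omega
  rw [if_pos hcond, hprod, hsum, Fintype.card_fin, ← hs] at h
  rw [← h, show n - (2 * r - z) = n - 2 * r + z by omega]
  simp [hm]

theorem card_shortPerms_zero_pos {n r : ℕ} (hn : 2 * r ≤ n) : 0 < (shortPerms n r 0).card :=
  Nat.pos_of_ne_zero fun h => by
    have := card_shortPerms_mul (z := 0) (by omega) hn
    rw [h, zero_mul] at this
    exact n.factorial_ne_zero this.symm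

theorem card_shortPerms_eq {n r : ℕ} (z : ℕ) (hn : 2 * r ≤ n) :
    (shortPerms n r z).card * (z.factorial * 3 ^ z * (n - 2 * r + 1).ascFactorial z) =
      (shortPerms n r 0).card * (r.descFactorial (2 * z) * 4 ^ z) := by
  by_cases hz : 2 * z ≤ r
  · have h1 := card_shortPerms_mul hz hn
    have h0 := card_shortPerms_mul (z := 0) (by omega) hn
    rw [← h0, ← Nat.factorial_mul_ascFactorial] at h1
    have h2 : 2 ^ r = 2 ^ (r - 2 * z) * 4 ^ z := by
      rw [show (4 : ℕ) = 2 ^ 2 by norm_num, ← pow_mul, ← pow_add]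
      congr 1
      omega
    simp only [mul_zero, Nat.sub_zero, Nat.add_zero, pow_zero, mul_one, Nat.factorial_zero] at h1
    rw [h2, ← Nat.factorial_mul_descFactorial hz] at h1
    have hpos : 0 < (n - 2 * r).factorial * 2 ^ (r - 2 * z) * (r - 2 * z).factorial := by
      positivity
    refine Nat.eq_of_mul_eq_mul_left hpos ?_
    linarith
  · rw [shortPerms_eq_empty (by omega), Nat.descFactorial_of_lt (by omega)]
    simp

theorem one_add_pow_le_one_add_mul_four_pow {δ : ℝ} (h0 : 0 ≤ δ) (h1 : δ ≤ 1) (z : ℕ) :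
    (1 + δ) ^ z ≤ 1 + δ * 4 ^ z := by
  induction z with
  | zero => simp [h0]
  | succ z ih =>
    have h4 : (1 : ℝ) ≤ 4 ^ z := one_le_pow₀ (by norm_num)
    rw [pow_succ, pow_succ]
    nlinarith [mul_nonneg h0 (sub_nonneg.2 h1), mul_nonneg h0 (sub_nonneg.2 h4),
      mul_nonneg (mul_nonneg h0 (sub_nonneg.2 h1)) (sub_nonneg.2 h4)]

theorem one_sub_mul_pow_le_descFactorial {r : ℕ} (hr : 1 ≤ r) (z : ℕ) :
    (1 - 4 / (r : ℝ) * 4 ^ z) * (r : ℝ) ^ (2 * z) ≤ (r.descFactorial (2 * z) : ℝ) := by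
  have hr' : (0 : ℝ) < r := by exact_mod_cast hr
  have hzz : (z : ℝ) ^ 2 ≤ 4 ^ z := by
    have : (z : ℝ) ≤ 2 ^ z := by exact_mod_cast Nat.lt_two_pow_self.le
    calc (z : ℝ) ^ 2 ≤ (2 ^ z) ^ 2 := by gcongr
      _ = 4 ^ z := by rw [← pow_mul, mul_comm, pow_mul]; norm_num
  have hle : 1 - 4 / (r : ℝ) * 4 ^ z ≤ 1 - 4 * (z : ℝ) ^ 2 / r := by
    have : 4 * (z : ℝ) ^ 2 / r ≤ 4 / (r : ℝ) * 4 ^ z := by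
      rw [mul_div_right_comm]; gcongr
    linarith
  refine (mul_le_mul_of_nonneg_right hle (by positivity)).trans ?_
  by_cases hz : 2 * z ≤ r
  · have hz' : (2 : ℝ) * z ≤ r := by exact_mod_cast hz
    have h1 : ((r - 2 * z : ℝ)) ^ (2 * z) ≤ (r.descFactorial (2 * z) : ℝ) := by
      have h := Nat.pow_sub_le_descFactorial r (2 * z)
      calc ((r - 2 * z : ℝ)) ^ (2 * z) ≤ ((r + 1 - 2 * z : ℕ) : ℝ) ^ (2 * z) := by
            refine pow_le_pow_left₀ (by linarith) ?_ _
            rw [Nat.cast_sub (by omega)]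
            push_cast
            linarith
        _ ≤ _ := by exact_mod_cast h
    have h2 := one_add_mul_le_pow (a := -(2 * z / r : ℝ)) (by
      have : (2 * z / r : ℝ) ≤ 1 := by rw [div_le_one hr']; exact hz'
      linarith) (2 * z)
    calc (1 - 4 * (z : ℝ) ^ 2 / r) * (r : ℝ) ^ (2 * z)
        = (1 + ((2 * z : ℕ) : ℝ) * -(2 * z / r : ℝ)) * (r : ℝ) ^ (2 * z) := by
          push_cast; ring
      _ ≤ (1 + -(2 * z / r : ℝ)) ^ (2 * z) * (r : ℝ) ^ (2 * z) := by gcongr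
      _ = ((r - 2 * z : ℝ)) ^ (2 * z) := by
          rw [← mul_pow]
          congr 1
          field_simp
          ring
      _ ≤ _ := h1
  · have hz' : (r : ℝ) ≤ 2 * z := by exact_mod_cast (by omega : r ≤ 2 * z)
    have hr1 : (1 : ℝ) ≤ r := by exact_mod_cast hr
    have : 1 ≤ 4 * (z : ℝ) ^ 2 / r := by
      rw [le_div_iff₀ hr']
      nlinarith
    refine (mul_nonpos_of_nonpos_of_nonneg (by linarith) (by positivity)).trans (by positivity)

theorem abs_card_shortPerms_div_sub_le {n r : ℕ} (hr : 1 ≤ r) (hn : 12 * r ≤ n) (z : ℕ) :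
    |((shortPerms n r z).card : ℝ) / (shortPerms n r 0).card -
        (4 / 3 * (r : ℝ) ^ 2 / n) ^ z / z.factorial| ≤
      (4 / r + 4 * r / n) * ((4 * (4 / 3 * (r : ℝ) ^ 2 / n)) ^ z / z.factorial) := by
  have hr' : (1 : ℝ) ≤ r := by exact_mod_cast hr
  have hn' : (12 : ℝ) * r ≤ n := by exact_mod_cast hn
  have hn0 : (0 : ℝ) < n := by linarith
  have hr0 : (0 : ℝ) < r := by linarith
  have hw0 : (0 : ℝ) < (shortPerms n r 0).card := by
    exact_mod_cast card_shortPerms_zero_pos (by omega)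
  have hf : (0 : ℝ) < z.factorial := by exact_mod_cast z.factorial_pos
  have hsub : ((n - 2 * r + 1 : ℕ) : ℝ) = n - 2 * r + 1 := by
    rw [Nat.cast_add, Nat.cast_sub (by omega)]
    push_cast
    ring
  have hasc : (n - 2 * r : ℝ) ^ z ≤ ((n - 2 * r + 1).ascFactorial z : ℝ) := by
    calc (n - 2 * r : ℝ) ^ z ≤ ((n - 2 * r + 1 : ℕ) : ℝ) ^ z :=
          pow_le_pow_left₀ (by linarith) (by rw [hsub]; linarith) _
      _ ≤ _ := by exact_mod_cast Nat.pow_succ_le_ascFactorial _ _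
  have hasc0 : (0 : ℝ) < ((n - 2 * r + 1).ascFactorial z : ℝ) :=
    (pow_pos (by linarith) z).trans_le hasc
  have heq : ((shortPerms n r z).card : ℝ) / (shortPerms n r 0).card =
      (r.descFactorial (2 * z) : ℝ) * 4 ^ z /
        (z.factorial * 3 ^ z * (n - 2 * r + 1).ascFactorial z) := by
    rw [div_eq_div_iff hw0.ne' (by positivity), mul_comm _ ((shortPerms n r 0).card : ℝ)]
    exact_mod_cast card_shortPerms_eq z (by omega)
  set l : ℝ := 4 / 3 * (r : ℝ) ^ 2 / n with hl
  have hl0 : 0 ≤ l := by positivity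
  have hlz : l ^ z * n ^ z * 3 ^ z = 4 ^ z * (r : ℝ) ^ (2 * z) := by
    rw [pow_mul, ← mul_pow, ← mul_pow, ← mul_pow]
    congr 1
    rw [hl]; field_simp
  rw [heq, abs_le]
  constructor
  · have hlow : (1 - 4 / (r : ℝ) * 4 ^ z) * (l ^ z / z.factorial) ≤
        (r.descFactorial (2 * z) : ℝ) * 4 ^ z /
          (z.factorial * 3 ^ z * (n - 2 * r + 1).ascFactorial z) := by
      by_cases hz : 2 * z ≤ r
      · have hasc' : ((n - 2 * r + 1).ascFactorial z : ℝ) ≤ (n : ℝ) ^ z := by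
          have h1 : (n - 2 * r + 1).ascFactorial z ≤ (n - 2 * r + z) ^ z :=
            Nat.ascFactorial_le_pow_add _ _
          have h2 : (n - 2 * r + z) ^ z ≤ n ^ z := Nat.pow_le_pow_left (by omega) _
          exact_mod_cast h1.trans h2
        calc (1 - 4 / (r : ℝ) * 4 ^ z) * (l ^ z / z.factorial)
            = ((1 - 4 / (r : ℝ) * 4 ^ z) * r ^ (2 * z)) * 4 ^ z /
                (z.factorial * 3 ^ z * n ^ z) := by
              field_simp
              linear_combination (r - 4 * 4 ^ z : ℝ) * hlz
          _ ≤ (r.descFactorial (2 * z) : ℝ) * 4 ^ z / (z.factorial * 3 ^ z * n ^ z) := by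
              gcongr
              exact one_sub_mul_pow_le_descFactorial hr z
          _ ≤ _ := by gcongr
      · have h := one_sub_mul_pow_le_descFactorial hr z
        rw [Nat.descFactorial_of_lt (by omega)] at h ⊢
        have h3 : 1 - 4 / (r : ℝ) * 4 ^ z ≤ 0 := by
          by_contra! hc
          have := mul_pos hc (pow_pos hr0 (2 * z))
          simp only [Nat.cast_zero] at h
          linarith
        simp only [Nat.cast_zero, zero_mul, zero_div]
        exact mul_nonpos_of_nonpos_of_nonneg h3 (by positivity)
    have : 0 ≤ 4 * r / n * ((4 * l) ^ z / z.factorial) := by positivity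
    rw [mul_pow] at this ⊢
    have e : (4 / (r : ℝ) + 4 * r / n) * (4 ^ z * l ^ z / z.factorial) =
      4 / (r : ℝ) * 4 ^ z * (l ^ z / z.factorial) +
        4 * r / n * (4 ^ z * l ^ z / z.factorial) := by ring
    linarith
  · have hup : (r.descFactorial (2 * z) : ℝ) * 4 ^ z /
          (z.factorial * 3 ^ z * (n - 2 * r + 1).ascFactorial z) ≤
        (1 + 4 * r / n * 4 ^ z) * (l ^ z / z.factorial) := by
      have hd : (r.descFactorial (2 * z) : ℝ) ≤ (r : ℝ) ^ (2 * z) := by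
        exact_mod_cast Nat.descFactorial_le_pow _ _
      have hpos : 0 < (n - 2 * r : ℝ) := by linarith
      have hratio : (n : ℝ) / (n - 2 * r) ≤ 1 + 4 * r / n := by
        rw [div_le_iff₀ hpos]
        have h8 : 4 * r / n * (2 * r : ℝ) ≤ 2 * r := by
          rw [div_mul_eq_mul_div, div_le_iff₀ hn0]
          nlinarith
        have h9 : 4 * r / n * (n : ℝ) = 4 * r := by field_simp
        nlinarith
      have hδ : 4 * (r : ℝ) / n ≤ 1 := by
        rw [div_le_one hn0]; linarith
      calc _ ≤ (r : ℝ) ^ (2 * z) * 4 ^ z / (z.factorial * 3 ^ z * (n - 2 * r : ℝ) ^ z) := by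
            gcongr
        _ = ((n : ℝ) / (n - 2 * r)) ^ z * (l ^ z / z.factorial) := by
            rw [div_pow]
            field_simp
            linear_combination -hlz
        _ ≤ (1 + 4 * r / n) ^ z * (l ^ z / z.factorial) := by gcongr
        _ ≤ _ := by
            gcongr
            exact one_add_pow_le_one_add_mul_four_pow (by positivity) hδ z
    have : 0 ≤ 4 / r * ((4 * l) ^ z / z.factorial) := by positivity
    rw [mul_pow] at this ⊢
    have e : (4 / (r : ℝ) + 4 * r / n) * (4 ^ z * l ^ z / z.factorial) =
      4 * r / n * 4 ^ z * (l ^ z / z.factorial) +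
        4 / r * (4 ^ z * l ^ z / z.factorial) := by ring
    linarith

theorem Real.hasSum_pow_div_factorial (x : ℝ) :
    HasSum (fun z : ℕ => x ^ z / z.factorial) (Real.exp x) := by
  rw [Real.exp_eq_exp_ℝ]
  exact NormedSpace.expSeries_div_hasSum_exp x

/-- If the unnormalised weights `u` are close to those of the Poisson distribution, then any
distribution proportional to `u`, up to a part of mass `B / S`, is close to it. -/
theorem abs_mixture_sub_poisson_le {u a : ℕ → ℝ} {S B b l M ε : ℝ}
    (hu0 : ∀ z, 0 ≤ u z) (hu : Summable u) (ha0 : ∀ z, 0 ≤ a z) (ha1 : ∀ z, a z ≤ 1)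
    (hb0 : 0 ≤ b) (hbB : b ≤ B) (hS0 : 0 < S) (hS : S = B + ∑' z, u z) (hl : 0 ≤ l)
    (hε : ∀ z, |u z - l ^ z / z.factorial| ≤ ε * (M ^ z / z.factorial)) :
    |(b + ∑' z, a z * u z) / S - ∑' z, a z * (Real.exp (-l) * l ^ z / z.factorial)| ≤
      2 * (B / S) + 2 * (ε * Real.exp M) := by
  set e : ℕ → ℝ := fun z => l ^ z / z.factorial with he
  have he0 : ∀ z, 0 ≤ e z := fun z => by positivity
  have heS : HasSum e (Real.exp l) := Real.hasSum_pow_div_factorial l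
  have hM : HasSum (fun z => ε * (M ^ z / z.factorial)) (ε * Real.exp M) :=
    (Real.hasSum_pow_div_factorial M).mul_left ε
  have hau : Summable fun z => a z * u z :=
    Summable.of_nonneg_of_le (fun z => mul_nonneg (ha0 z) (hu0 z))
      (fun z => mul_le_of_le_one_left (hu0 z) (ha1 z)) hu
  have hae : Summable fun z => a z * e z :=
    Summable.of_nonneg_of_le (fun z => mul_nonneg (ha0 z) (he0 z))
      (fun z => mul_le_of_le_one_left (he0 z) (ha1 z)) heS.summable
  set U := ∑' z, u z with hU
  set V := ∑' z, a z * u z with hV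
  set W := ∑' z, a z * e z with hW
  set η := ε * Real.exp M with hη
  have hV0 : 0 ≤ V := tsum_nonneg fun z => mul_nonneg (ha0 z) (hu0 z)
  have hVU : V ≤ U := hau.tsum_le_tsum (fun z => mul_le_of_le_one_left (hu0 z) (ha1 z)) hu
  have hUE : |U - Real.exp l| ≤ η := by
    have h := hu.hasSum.sub heS
    rw [← h.tsum_eq, ← Real.norm_eq_abs]
    exact tsum_of_norm_bounded hM hε
  have hVW : |V - W| ≤ η := by
    have h := hau.hasSum.sub hae.hasSum
    rw [hV, hW, ← h.tsum_eq, ← Real.norm_eq_abs]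
    refine tsum_of_norm_bounded hM fun z => ?_
    rw [← mul_sub, norm_mul, Real.norm_eq_abs, Real.norm_eq_abs, abs_of_nonneg (ha0 z)]
    exact (mul_le_of_le_one_left (abs_nonneg _) (ha1 z)).trans (hε z)
  have hPoisson : ∑' z, a z * (Real.exp (-l) * l ^ z / z.factorial) = W / Real.exp l := by
    rw [hW, ← tsum_div_const]
    refine tsum_congr fun z => ?_
    rw [he, Real.exp_neg]
    field_simp
  have hE1 : 1 ≤ Real.exp l := Real.one_le_exp hl
  have hE0 : 0 < Real.exp l := by linarith
  have hη0 : 0 ≤ η := (abs_nonneg _).trans hUE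
  have hdiv : ∀ x : ℝ, |x| ≤ η → |x / Real.exp l| ≤ η := fun x hx => by
    rw [abs_div, abs_of_pos hE0]
    exact (div_le_self (abs_nonneg _) hE1).trans hx
  have h1 : |V * (1 / S - 1 / Real.exp l)| ≤ B / S + η := by
    calc |V * (1 / S - 1 / Real.exp l)| = V * |1 / S - 1 / Real.exp l| := by
          rw [abs_mul, abs_of_nonneg hV0]
      _ ≤ U * |1 / S - 1 / Real.exp l| := by gcongr
      _ = |U * (1 / S - 1 / Real.exp l)| := by
          rw [abs_mul, abs_of_nonneg (hV0.trans hVU)]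
      _ = |-(B / S) - (U - Real.exp l) / Real.exp l| := by
          congr 1
          rw [show U = S - B by linarith]
          field_simp
          ring
      _ ≤ |-(B / S)| + |(U - Real.exp l) / Real.exp l| := abs_sub _ _
      _ ≤ B / S + η := by
          rw [abs_neg, abs_of_nonneg (div_nonneg (hb0.trans hbB) hS0.le)]
          exact add_le_add le_rfl (hdiv _ hUE)
  have h2 : |b / S| ≤ B / S := by
    rw [abs_of_nonneg (div_nonneg hb0 hS0.le)]
    gcongr
  rw [hPoisson, show (b + V) / S - W / Real.exp l =
    b / S + V * (1 / S - 1 / Real.exp l) + (V - W) / Real.exp l by ring]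
  have h3 := abs_add_three (b / S) (V * (1 / S - 1 / Real.exp l)) ((V - W) / Real.exp l)
  have h4 := hdiv _ hVW
  linarith

theorem card_eq_card_long_add_sum_card_short {n r : ℕ} {D : Finset (Equiv.Perm (Fin n))}
    (hD : D ⊆ permsOfDefect n r) :
    D.card = (D.filter fun σ => ¬∀ m ∈ σ.cycleType, m ≤ 3).card +
      ∑ z ∈ Finset.range (r + 1), (D.filter fun σ => σ ∈ shortPerms n r z).card := by
  have hmaps : Set.MapsTo (fun σ : Equiv.Perm (Fin n) => σ.cycleType.count 3)
      (D.filter fun σ => ∀ m ∈ σ.cycleType, m ≤ 3) (Finset.range (r + 1)) := by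
    intro σ hσ
    obtain ⟨hσD, h3⟩ := Finset.mem_filter.1 (Finset.mem_coe.1 hσ)
    have := (mem_shortPerms_iff.1 (Finset.mem_filter.2 ⟨hD hσD, h3, rfl⟩)).1
    simp only [Finset.coe_range, Set.mem_Iio]
    omega
  rw [← Finset.card_filter_add_card_filter_not (s := D)
    (fun σ => ∀ m ∈ σ.cycleType, m ≤ 3), add_comm, Finset.card_eq_sum_card_fiberwise hmaps]
  congr 1
  refine Finset.sum_congr rfl fun z _ => ?_
  rw [Finset.filter_filter]
  congr 1
  refine Finset.filter_congr fun σ hσ => ?_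
  simp [shortPerms, hD hσ]

theorem cycleCount_eq_of_mem_shortPerms {n k r z : ℕ} (h : k + r = n)
    {σ : Equiv.Perm (Fin n)} (hσ : σ ∈ shortPerms n r z) (i : ℕ) :
    (cycleCount σ i : ℤ) = if i = 1 then 2 * (k : ℤ) - n + z
      else if i = 2 then (r : ℤ) - 2 * z else if i = 3 then (z : ℤ) else 0 := by
  obtain ⟨hz, hct⟩ := mem_shortPerms_iff.1 hσ
  have h1 := card_fixed_add_card_support σ
  have h2 := σ.sum_cycleType
  rw [hct] at h2
  simp only [Multiset.sum_add, Multiset.sum_replicate, smul_eq_mul] at h2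
  rw [cycleCount, hct]
  simp only [Multiset.count_add, Multiset.count_replicate]
  split_ifs <;> omega

open scoped Classical in
theorem permProb_eq {n k r : ℕ} (h : k + r = n) (E : Equiv.Perm (Fin n) → Prop) :
    permProb n k E = (((permsOfDefect n r).filter E).card : ℝ) / (permsOfDefect n r).card := by
  have h1 : Nat.card {σ : Equiv.Perm (Fin n) // numCycles σ = k ∧ E σ} =
      ((permsOfDefect n r).filter E).card := by
    rw [← Nat.card_eq_finsetCard]
    refine Nat.card_congr (Equiv.subtypeEquivRight fun σ => ?_)
    rw [Finset.mem_filter, numCycles_eq_iff h]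
  have h2 : Nat.card {σ : Equiv.Perm (Fin n) // numCycles σ = k} =
      (permsOfDefect n r).card := by
    rw [← Nat.card_eq_finsetCard]
    exact Nat.card_congr (Equiv.subtypeEquivRight fun σ => numCycles_eq_iff h σ)
  rw [permProb, h1, h2]

/-- The total variation bound for one event and fixed `n`, `k`, with explicit constants. -/
theorem abs_permProb_sub_poisson_le {n k r : ℕ} (h : k + r = n) (hr : 1 ≤ r) (hn : 12 * r ≤ n)
    (A : Set (ℕ → ℤ)) :
    |permProb n k (fun σ => (fun i => (cycleCount σ i : ℤ)) ∈ A) -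
      ∑' z : ℕ, A.indicator
        (fun _ => ProbabilityTheory.poissonPMFReal (Real.toNNReal ((4/3) * (r : ℝ) ^ 2 / n)) z)
        (fun i => if i = 1 then 2 * (k : ℤ) - n + z
          else if i = 2 then (r : ℤ) - 2 * z else if i = 3 then (z : ℤ) else 0)| ≤
      864 * ((r : ℝ) ^ 3 / (n : ℝ) ^ 2) +
        2 * ((4 / r + 4 * r / n) * Real.exp (4 * (4 / 3 * (r : ℝ) ^ 2 / n))) := by
  classical
  set v : ℕ → ℕ → ℤ := fun z i => if i = 1 then 2 * (k : ℤ) - n + z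
    else if i = 2 then (r : ℤ) - 2 * z else if i = 3 then (z : ℤ) else 0 with hv
  set D := (permsOfDefect n r).filter fun σ => (fun i => (cycleCount σ i : ℤ)) ∈ A with hD
  set a : ℕ → ℝ := fun z => if v z ∈ A then 1 else 0 with ha
  set l : ℝ := 4 / 3 * (r : ℝ) ^ 2 / n with hl
  have hl0 : 0 ≤ l := by positivity
  set c : ℝ := ((shortPerms n r 0).card : ℝ) with hc
  have hc0 : 0 < c := by
    rw [hc]
    exact_mod_cast card_shortPerms_zero_pos (by omega)
  set u : ℕ → ℝ := fun z => ((shortPerms n r z).card : ℝ) / c with hu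
  have hu_eq_zero : ∀ z ∉ Finset.range (r + 1), u z = 0 := fun z hz => by
    rw [Finset.mem_range] at hz
    simp only [hu]
    rw [shortPerms_eq_empty (by omega), Finset.card_empty, Nat.cast_zero, zero_div]
  have hsu : Summable u := summable_of_ne_finset_zero hu_eq_zero
  set B := (permsOfDefect n r).filter fun σ => ¬∀ m ∈ σ.cycleType, m ≤ 3 with hB
  set b := D.filter fun σ => ¬∀ m ∈ σ.cycleType, m ≤ 3 with hb
  have hS : ((permsOfDefect n r).card : ℝ) / c = B.card / c + ∑' z, u z := by
    rw [tsum_eq_sum hu_eq_zero, ← Finset.sum_div, ← add_div]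
    congr 1
    rw [card_eq_card_long_add_sum_card_short (Finset.Subset.refl (permsOfDefect n r))]
    push_cast
    congr 1
    refine Finset.sum_congr rfl fun z _ => ?_
    congr 2
    ext σ
    simp +contextual [shortPerms]
  have hDS : (D.card : ℝ) / c = b.card / c + ∑' z, a z * u z := by
    rw [tsum_eq_sum (s := Finset.range (r + 1)) fun z hz => by rw [hu_eq_zero z hz, mul_zero],
      card_eq_card_long_add_sum_card_short (Finset.filter_subset _ _ : D ⊆ permsOfDefect n r)]
    push_cast
    rw [add_div, Finset.sum_div]
    congr 1
    refine Finset.sum_congr rfl fun z _ => ?_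
    simp only [ha, hu]
    rw [← mul_div_assoc]
    congr 1
    have hmem : ∀ σ ∈ shortPerms n r z, (fun i => (cycleCount σ i : ℤ)) = v z := fun σ hσ =>
      funext fun i => cycleCount_eq_of_mem_shortPerms h hσ i
    split_ifs with hvA
    · rw [one_mul]
      congr 2
      ext σ
      rw [Finset.mem_filter, and_iff_right_iff_imp]
      intro hσ
      rw [Finset.mem_filter, hmem σ hσ]
      exact ⟨(Finset.mem_filter.1 hσ).1, hvA⟩
    · rw [zero_mul, Nat.cast_eq_zero, Finset.card_eq_zero, Finset.filter_eq_empty_iff]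
      intro σ hσD hσ
      rw [Finset.mem_filter, hmem σ hσ] at hσD
      exact hvA hσD.2
  have hSpos : (0 : ℝ) < (permsOfDefect n r).card := by
    have : (shortPerms n r 0).card ≤ (permsOfDefect n r).card :=
      Finset.card_le_card (Finset.filter_subset _ _)
    exact_mod_cast (card_shortPerms_zero_pos (by omega)).trans_le this
  have hbB : (b.card : ℝ) / c ≤ B.card / c := by
    gcongr
    exact Finset.filter_subset_filter _ (Finset.filter_subset _ _)
  have hmain := abs_mixture_sub_poisson_le (a := a) (fun z => by positivity) hsu
    (fun z => by simp only [ha]; split_ifs <;> norm_num)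
    (fun z => by simp only [ha]; split_ifs <;> norm_num) (by positivity) hbB
    (div_pos hSpos hc0) hS hl0 (abs_card_shortPerms_div_sub_le hr hn)
  rw [← hDS, div_div_div_cancel_right₀ hc0.ne', div_div_div_cancel_right₀ hc0.ne',
    ← permProb_eq h] at hmain
  have hpois : ∀ z, A.indicator
      (fun _ => ProbabilityTheory.poissonPMFReal (Real.toNNReal l) z) (v z) =
      a z * (Real.exp (-l) * l ^ z / z.factorial) := fun z => by
    simp only [ha, Set.indicator_apply, ProbabilityTheory.poissonPMFReal,
      Real.coe_toNNReal l hl0]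
    split_ifs <;> simp
  have hBle : (B.card : ℝ) / (permsOfDefect n r).card ≤
      432 * ((r : ℝ) ^ 3 / (n : ℝ) ^ 2) := by
    rw [div_le_iff₀ hSpos]
    exact card_permsOfDefect_exists_long_le_mul hr hn
  rw [tsum_congr hpois]
  linarith

/-- let `t > 0` and `k(n)` be an increasing sequence of positive integers with
`(n − k(n))/√n → t`. Let `C = (C_1, C_2, …)` be the cycle-length counts of a uniformly random
permutation of `{1,…,n}` with exactly `k(n)` cycles and let `Z₁` be Poisson with mean
`(4/3)(n−k)²/n`. Then there are `K > 0` and `N` such that for all `n ≥ N` the total variation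
distance between `C` and `(2k − n + Z₁, (n−k) − 2Z₁, Z₁, 0, 0, …)` is at most
`K·exp((2/3)(n−k)²/n)·(n−k)³/n²`. -/
theorem permutation_cycle_structure (t : ℝ) (ht : 0 < t) (k : ℕ → ℕ)
    (hmono : Monotone k) (hpos : ∀ n, 0 < k n)
    (hlim : Tendsto (fun n : ℕ => ((n - k n : ℕ) : ℝ) / Real.sqrt n) atTop (nhds t)) :
    ∃ K > (0 : ℝ), ∃ N : ℕ, ∀ n ≥ N,
      (⨆ A : Set (ℕ → ℤ),
        |permProb n (k n) (fun σ => (fun i => (cycleCount σ i : ℤ)) ∈ A) -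
          ∑' z : ℕ,
            A.indicator
              (fun _ => ProbabilityTheory.poissonPMFReal
                (Real.toNNReal ((4/3) * ((n - k n : ℕ) : ℝ) ^ 2 / n)) z)
              (fun i => if i = 1 then 2 * (k n : ℤ) - n + z
                else if i = 2 then ((n - k n : ℕ) : ℤ) - 2 * z
                else if i = 3 then (z : ℤ) else 0)|)
        ≤ K * Real.exp ((2/3) * ((n - k n : ℕ) : ℝ) ^ 2 / n) *
            ((n - k n : ℕ) : ℝ) ^ 3 / (n : ℝ) ^ 2 := by
  refine ⟨864 + 2 * ((64 / t ^ 4 + 16 / t ^ 2) * Real.exp (64 / 3 * t ^ 2)), by positivity, ?_⟩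
  have hsqrt : Tendsto (fun n : ℕ => Real.sqrt n) atTop atTop :=
    Real.tendsto_sqrt_atTop.comp tendsto_natCast_atTop_atTop
  obtain ⟨N, hN⟩ := eventually_atTop.1
    (((hlim.eventually_const_lt (half_lt_self ht)).and
      (hlim.eventually_lt_const (by linarith : t < 2 * t))).and
      (hsqrt.eventually_gt_atTop (24 * t)))
  refine ⟨N, fun n hn => ?_⟩
  obtain ⟨⟨h1, h2⟩, h3⟩ := hN n hn
  set r := n - k n with hr
  set s := Real.sqrt n with hs
  have hs0 : 0 < s := by linarith
  have hsn : s ^ 2 = n := Real.sq_sqrt (Nat.cast_nonneg n)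
  rw [lt_div_iff₀ hs0] at h1
  rw [div_lt_iff₀ hs0] at h2
  have hr0 : (0 : ℝ) < r := lt_trans (by positivity) h1
  have hr1 : 1 ≤ r := by exact_mod_cast hr0
  have hn0 : (0 : ℝ) < n := by rw [← hsn]; positivity
  have hrn : 12 * r ≤ n := by
    have : (12 : ℝ) * r ≤ n := by rw [← hsn]; nlinarith
    exact_mod_cast this
  have hkr : k n + r = n := by omega
  have hsq : t ^ 2 * n ≤ 4 * (r : ℝ) ^ 2 := by
    rw [← hsn]
    have := pow_le_pow_left₀ (by positivity) h1.le 2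
    nlinarith
  have hsq' : (r : ℝ) ^ 2 / n ≤ 4 * t ^ 2 := by
    rw [div_le_iff₀ hn0, ← hsn]
    have := pow_le_pow_left₀ hr0.le h2.le 2
    nlinarith
  set q : ℝ := (r : ℝ) ^ 3 / (n : ℝ) ^ 2 with hq
  have hq0 : 0 < q := by positivity
  have hinv : 4 / (r : ℝ) ≤ 64 / t ^ 4 * q := by
    rw [hq, div_mul_div_comm, div_le_div_iff₀ hr0 (by positivity)]
    have := pow_le_pow_left₀ (by positivity) hsq 2
    nlinarith
  have hfrac : 4 * (r : ℝ) / n ≤ 16 / t ^ 2 * q := by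
    rw [hq, div_mul_div_comm, div_le_div_iff₀ hn0 (by positivity)]
    have := mul_le_mul_of_nonneg_right hsq (by positivity : (0 : ℝ) ≤ 4 * r * n)
    nlinarith
  have hexp : Real.exp (4 * (4 / 3 * (r : ℝ) ^ 2 / n)) ≤ Real.exp (64 / 3 * t ^ 2) := by
    refine Real.exp_le_exp.2 ?_
    rw [mul_div_assoc]
    linarith
  refine ciSup_le fun A => (abs_permProb_sub_poisson_le hkr hr1 hrn A).trans ?_
  calc 864 * q + 2 * ((4 / r + 4 * r / n) * Real.exp (4 * (4 / 3 * (r : ℝ) ^ 2 / n)))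
      ≤ 864 * q + 2 * ((64 / t ^ 4 * q + 16 / t ^ 2 * q) * Real.exp (64 / 3 * t ^ 2)) := by
        gcongr
    _ = (864 + 2 * ((64 / t ^ 4 + 16 / t ^ 2) * Real.exp (64 / 3 * t ^ 2))) * 1 * q := by ring
    _ ≤ (864 + 2 * ((64 / t ^ 4 + 16 / t ^ 2) * Real.exp (64 / 3 * t ^ 2))) *
          Real.exp ((2/3) * (r : ℝ) ^ 2 / n) * q := by
        gcongr
        exact Real.one_le_exp (by positivity)
    _ = _ := by rw [hq]; ring
end

section
/- Let n ≥ 2 and 1 ≤ k ≤ n, set r = n − k, and define λ := (4/3)·binomial(r,2)·(n − 1/2)/(n(n−1)), c_1^A := r(r−1)(r−3/2)·(64/(9n²))·((n−1/2)²/(n−1)²), and c_2^A := r(r−1)(r−2)·(40/(3n²))·((n(n − 17/5) + 17/5)/(n−1)²). Then the Stirling number of the second kind satisfies (binomial(n,2)^r / r!) · e^{−2λ} · (1 − e^{2λ}(c_1^A + c_2^A)) ≤ S(n,k) ≤ (binomial(n,2)^r / r!) · e^{−2λ} · (1 + e^{2λ}(c_1^A + c_2^A)). -/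
open Finset Filter

/-- `S(n,k)`, the Stirling number of the second kind: the number of partitions of a set of
size `n` into exactly `k` (nonempty) blocks. -/
noncomputable def stirling2 (n k : ℕ) : ℕ :=
  Nat.card {P : Finpartition (Finset.univ : Finset (Fin n)) // P.parts.card = k}

namespace Finpartition

variable {α : Type*} [DecidableEq α] {s : Finset α} {a : α}

lemma sup_parts_erase (Q : Finpartition s) {B : Finset α} (hB : B ∈ insert ∅ Q.parts) :
    (Q.parts.erase B).sup id = s \ B := by
  ext x
  simp only [Finset.mem_sup, mem_erase, id, Finset.mem_sdiff]
  constructor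
  · rintro ⟨C, ⟨hCB, hC⟩, hx⟩
    refine ⟨Q.subset hC hx, fun hxB ↦ ?_⟩
    rcases mem_insert.1 hB with rfl | hB
    · simp at hxB
    · exact hCB (Q.eq_of_mem_parts hC hB hx hxB)
  · rintro ⟨hx, hxB⟩
    obtain ⟨C, hC, hxC⟩ := Q.exists_mem hx
    exact ⟨C, ⟨fun h ↦ hxB (h ▸ hxC), hC⟩, hxC⟩

lemma subset_of_mem_insert_empty (Q : Finpartition s) {B : Finset α}
    (hB : B ∈ insert ∅ Q.parts) : B ⊆ s := by
  rcases mem_insert.1 hB with rfl | hB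
  · simp
  · exact Q.subset hB

/-- Adjoin a new element `a` to a part `B` of a partition, or as a singleton part if `B = ∅`. -/
def insertElem (Q : Finpartition s) (ha : a ∉ s) (B : Finset α) (hB : B ∈ insert ∅ Q.parts) :
    Finpartition (insert a s) :=
  (Q.ofSubset (erase_subset B _) (Q.sup_parts_erase hB)).extend (b := insert a B)
    (insert_ne_empty a B)
    (by
      rw [Finset.disjoint_left]
      intro x hx hx'
      rw [Finset.mem_sdiff] at hx
      rcases mem_insert.1 hx' with rfl | h
      · exact ha hx.1
      · exact hx.2 h)
    (by
      have := Q.subset_of_mem_insert_empty hB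
      ext x
      simp only [sup_eq_union, mem_union, Finset.mem_sdiff, mem_insert]
      have := @this x
      tauto)

lemma parts_insertElem (Q : Finpartition s) (ha : a ∉ s) (B : Finset α)
    (hB : B ∈ insert ∅ Q.parts) :
    (Q.insertElem ha B hB).parts = insert (insert a B) (Q.parts.erase B) := rfl

lemma insert_notMem_parts (Q : Finpartition s) (ha : a ∉ s) (B : Finset α) :
    insert a B ∉ Q.parts := fun h ↦ ha (Q.subset h (mem_insert_self a B))

lemma card_parts_insertElem (Q : Finpartition s) (ha : a ∉ s) (B : Finset α)
    (hB : B ∈ insert ∅ Q.parts) :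
    #(Q.insertElem ha B hB).parts = if B = ∅ then #Q.parts + 1 else #Q.parts := by
  rw [parts_insertElem, card_insert_of_notMem
    fun h ↦ Q.insert_notMem_parts ha B (mem_of_mem_erase h)]
  split_ifs with h
  · rw [h, erase_eq_of_notMem Q.empty_notMem_parts]
  · exact card_erase_add_one ((mem_insert.1 hB).resolve_left h)

lemma insertElem_injective {Q Q' : Finpartition s} (ha : a ∉ s) {B B' : Finset α}
    {hB : B ∈ insert ∅ Q.parts} {hB' : B' ∈ insert ∅ Q'.parts}
    (h : Q.insertElem ha B hB = Q'.insertElem ha B' hB') : Q = Q' ∧ B = B' := by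
  have haB : a ∉ B := fun h ↦ ha (Q.subset_of_mem_insert_empty hB h)
  have haB' : a ∉ B' := fun h ↦ ha (Q'.subset_of_mem_insert_empty hB' h)
  have hp := congrArg Finpartition.parts h
  have hBB : B = B' := by
    rw [← erase_insert haB, ← erase_insert haB']
    congr 1
    refine (Q.insertElem ha B hB).eq_of_mem_parts (a := a) ?_ ?_ (mem_insert_self _ _)
      (mem_insert_self _ _)
    · exact mem_insert_self _ _
    · rw [hp]; exact mem_insert_self _ _
  subst hBB
  refine ⟨?_, rfl⟩
  rw [parts_insertElem, parts_insertElem] at hp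
  have he : Q.parts.erase B = Q'.parts.erase B := by
    rw [← erase_insert (fun h ↦ Q.insert_notMem_parts ha B (mem_of_mem_erase h)), hp,
      erase_insert (fun h ↦ Q'.insert_notMem_parts ha B (mem_of_mem_erase h))]
  ext1
  by_cases h0 : B = ∅
  · rwa [h0, erase_eq_of_notMem Q.empty_notMem_parts,
      erase_eq_of_notMem Q'.empty_notMem_parts] at he
  · rw [← insert_erase ((mem_insert.1 hB).resolve_left h0), he,
      insert_erase ((mem_insert.1 hB').resolve_left h0)]

lemma exists_insertElem_eq (ha : a ∉ s) (P : Finpartition (insert a s)) :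
    ∃ (Q : Finpartition s) (B : Finset α) (hB : B ∈ insert ∅ Q.parts),
      Q.insertElem ha B hB = P := by
  have hs : insert a s \ {a} = s := by
    rw [sdiff_singleton_eq_erase, erase_insert ha]
  have hpart : P.part a ∈ P.parts := P.part_mem.2 (mem_insert_self a s)
  have hapart : a ∈ P.part a := P.mem_part_self.2 (mem_insert_self a s)
  have hother : ∀ C ∈ P.parts, C ≠ P.part a → a ∉ C := fun C hC hne haC ↦
    hne (P.part_eq_of_mem hC haC).symm
  have hmem (C : Finset α) : C ∈ ((P.avoid {a}).copy hs).parts ↔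
      (C ∈ P.parts ∧ C ≠ P.part a) ∨ (C = (P.part a).erase a ∧ C ≠ ∅) := by
    rw [copy_parts, mem_avoid]
    constructor
    · rintro ⟨D, hD, hle, rfl⟩
      by_cases hDa : D = P.part a
      · right
        subst hDa
        refine ⟨sdiff_singleton_eq_erase _ _, fun h ↦ hle (sdiff_eq_empty_iff_subset.1 h)⟩
      · left
        rw [Finset.sdiff_singleton_eq_erase, erase_eq_of_notMem (hother D hD hDa)]
        exact ⟨hD, hDa⟩
    · rintro (⟨hC, hne⟩ | ⟨rfl, hne⟩)
      · refine ⟨C, hC, fun hle ↦ ?_,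
          (sdiff_singleton_eq_erase _ _).trans (erase_eq_of_notMem (hother C hC hne))⟩
        obtain ⟨x, hx⟩ := P.nonempty_of_mem_parts hC
        exact hother C hC hne (mem_singleton.1 (hle hx) ▸ hx)
      · refine ⟨P.part a, hpart, fun hle ↦ hne ?_, sdiff_singleton_eq_erase _ _⟩
        rw [← sdiff_singleton_eq_erase]
        exact sdiff_eq_empty_iff_subset.2 hle
  have herase : (P.part a).erase a ∉ P.parts := by
    intro h
    obtain ⟨x, hx⟩ := P.nonempty_of_mem_parts h
    have := P.eq_of_mem_parts h hpart hx (mem_of_mem_erase hx)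
    rw [← this] at hapart
    simp at hapart
  refine ⟨(P.avoid {a}).copy hs, (P.part a).erase a, ?_, ?_⟩
  · rw [mem_insert, hmem]
    by_cases h : (P.part a).erase a = ∅ <;> simp [h]
  · ext C
    rw [parts_insertElem, mem_insert, mem_erase, hmem, insert_erase hapart]
    constructor
    · rintro (rfl | ⟨h1, h2 | h2⟩)
      · exact hpart
      · exact h2.1
      · exact absurd h2.1 h1
    · intro hC
      by_cases h : C = P.part a
      · exact Or.inl h
      · exact Or.inr ⟨fun h' ↦ herase (h' ▸ hC), Or.inl ⟨hC, h⟩⟩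

lemma card_filter_card_parts_insert (ha : a ∉ s) (k : ℕ) :
    #{P : Finpartition (insert a s) | #P.parts = k + 1} =
      #{Q : Finpartition s | #Q.parts = k} +
        (k + 1) * #{Q : Finpartition s | #Q.parts = k + 1} := by
  have key : #((univ : Finset (Finpartition s)).sigma fun Q ↦
      {B ∈ insert ∅ Q.parts | (if B = ∅ then #Q.parts + 1 else #Q.parts) = k + 1}) =
      #{P : Finpartition (insert a s) | #P.parts = k + 1} := by
    refine card_bij (fun x hx ↦ x.1.insertElem ha x.2
      (mem_filter.1 (mem_sigma.1 hx).2).1) ?_ ?_ ?_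
    · intro x hx
      rw [mem_filter, card_parts_insertElem]
      exact ⟨mem_univ _, (mem_filter.1 (mem_sigma.1 hx).2).2⟩
    · rintro ⟨Q, B⟩ hx ⟨Q', B'⟩ hx' h
      obtain ⟨rfl, rfl⟩ := insertElem_injective ha h
      rfl
    · intro P hP
      obtain ⟨Q, B, hB, rfl⟩ := exists_insertElem_eq ha P
      rw [mem_filter, card_parts_insertElem] at hP
      exact ⟨⟨Q, B⟩, mem_sigma.2 ⟨mem_univ _, mem_filter.2 ⟨hB, hP.2⟩⟩, rfl⟩
  have hfib (Q : Finpartition s) :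
      #{B ∈ insert ∅ Q.parts | (if B = ∅ then #Q.parts + 1 else #Q.parts) = k + 1} =
        (if #Q.parts = k then 1 else 0) + (k + 1) * (if #Q.parts = k + 1 then 1 else 0) := by
    have hne : ∀ B ∈ Q.parts, B ≠ ∅ := fun B hB ↦ Q.ne_empty hB
    rw [card_filter, sum_insert Q.empty_notMem_parts, if_pos rfl]
    congr 1
    · simp
    · rw [sum_congr rfl fun B hB ↦ by rw [if_neg (hne B hB)], sum_const, smul_eq_mul]
      split_ifs with h <;> simp [h]
  rw [← key, card_sigma, sum_congr rfl fun Q _ ↦ hfib Q, sum_add_distrib, ← mul_sum, card_filter,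
    card_filter]

lemma card_filter_card_parts (s : Finset α) (k : ℕ) :
    #{P : Finpartition s | #P.parts = k} = Nat.stirlingSecond #s k := by
  induction s using Finset.induction_on generalizing k with
  | empty =>
    have hP (P : Finpartition (∅ : Finset α)) : #P.parts = 0 := by
      rw [card_eq_zero]; exact P.parts_eq_empty_iff.2 rfl
    have : Fintype.card (Finpartition (∅ : Finset α)) = 1 :=
      Fintype.card_eq_one_iff.2 ⟨Finpartition.empty _, fun P ↦ by
        ext1; rw [card_eq_zero.1 (hP P), card_eq_zero.1 (hP _)]⟩
    cases k with
    | zero => simpa [hP, ← Finset.card_univ] using this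
    | succ k => simp [hP]
  | insert a s ha ih =>
    rw [card_insert_of_notMem ha]
    cases k with
    | zero =>
      rw [Nat.stirlingSecond_succ_zero, card_eq_zero, filter_eq_empty_iff]
      intro P _ h
      exact insert_ne_empty a s (P.parts_eq_empty_iff.1 (card_eq_zero.1 h))
    | succ k =>
      rw [card_filter_card_parts_insert ha, ih, ih, Nat.stirlingSecond_succ_succ, add_comm]

end Finpartition

lemma stirling2_eq_stirlingSecond (n k : ℕ) : stirling2 n k = Nat.stirlingSecond n k := by
  rw [stirling2, Nat.card_eq_fintype_card, Fintype.card_subtype,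
    Finpartition.card_filter_card_parts, card_univ, Fintype.card_fin]

/-- `corankStirling n r` is the Stirling number `S(n, n - r)`, which satisfies
`S(n + 1, n - r) = S(n, n - r - 1) + (n - r) S(n, n - r)`. -/
noncomputable def corankStirling : ℕ → ℕ → ℝ
  | 0, 0 => 1
  | 0, _ + 1 => 0
  | _ + 1, 0 => 1
  | n + 1, r + 1 => corankStirling n (r + 1) + ((n : ℝ) - r) * corankStirling n r

lemma corankStirling_zero_right (n : ℕ) : corankStirling n 0 = 1 := by
  cases n <;> simp [corankStirling]

lemma corankStirling_succ_succ (n r : ℕ) : corankStirling (n + 1) (r + 1) =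
    corankStirling n (r + 1) + ((n : ℝ) - r) * corankStirling n r := by
  simp [corankStirling]

lemma corankStirling_eq_zero {n r : ℕ} (hr : r ≠ 0) (h : n ≤ r) : corankStirling n r = 0 := by
  induction n generalizing r with
  | zero =>
    obtain ⟨r, rfl⟩ := Nat.exists_eq_succ_of_ne_zero hr
    simp [corankStirling]
  | succ n ih =>
    obtain ⟨r, rfl⟩ := Nat.exists_eq_succ_of_ne_zero hr
    rw [Nat.succ_eq_add_one, corankStirling_succ_succ, ih r.succ_ne_zero (by omega), zero_add]
    rcases eq_or_ne n r with rfl | hne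
    · simp
    · rw [ih (by omega) (by omega), mul_zero]

lemma corankStirling_nonneg (n r : ℕ) : 0 ≤ corankStirling n r := by
  induction n generalizing r with
  | zero => cases r <;> simp [corankStirling]
  | succ n ih =>
    cases r with
    | zero => simp [corankStirling]
    | succ r =>
      rw [corankStirling_succ_succ]
      rcases le_or_gt r n with h | h
      · have h' : (r : ℝ) ≤ n := by exact_mod_cast h
        have := mul_nonneg (sub_nonneg.2 h') (ih r)
        linarith [ih (r + 1)]
      · rw [corankStirling_eq_zero (n := n) (r := r) (by omega) h.le, mul_zero, add_zero]
        exact ih _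

lemma corankStirling_add_left (k r : ℕ) (hk : 1 ≤ k) :
    corankStirling (k + r) r = Nat.stirlingSecond (k + r) k := by
  suffices h : ∀ n k r : ℕ, 1 ≤ k → n = k + r → corankStirling n r = Nat.stirlingSecond n k from
    h _ _ _ hk rfl
  intro n
  induction n with
  | zero => intros; omega
  | succ n ih =>
    intro k r hk hn
    obtain ⟨k, rfl⟩ := Nat.exists_eq_add_of_le' hk
    cases r with
    | zero =>
      obtain rfl : n = k := by omega
      simp [corankStirling, Nat.stirlingSecond_self]
    | succ r =>
      have hnr : (n : ℝ) - r = k + 1 := by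
        rw [show n = k + 1 + r by omega]; push_cast; ring
      rw [corankStirling_succ_succ, Nat.stirlingSecond_succ_succ,
        ih (k + 1) r (by omega) (by omega), hnr]
      rcases Nat.eq_zero_or_pos k with rfl | hk'
      · rw [corankStirling_eq_zero (by omega) (by omega)]
        obtain ⟨m, rfl⟩ : ∃ m, n = m + 1 := ⟨n - 1, by omega⟩
        simp
      · rw [ih k (r + 1) hk' (by omega)]
        push_cast
        ring

lemma succ_mul_corankStirling_le (n r : ℕ) :
    ((r : ℝ) + 1) * corankStirling n (r + 1) ≤ (n : ℝ) * (n - 1) / 2 * corankStirling n r := by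
  induction n generalizing r with
  | zero => simp [corankStirling]
  | succ n ih =>
    rcases le_or_gt (n + 1) (r + 1) with h | h
    · rw [corankStirling_eq_zero (by omega) h, mul_zero]
      push_cast
      have : (0 : ℝ) ≤ n := n.cast_nonneg
      exact mul_nonneg (by ring_nf; positivity) (corankStirling_nonneg _ _)
    · have hrn : (r : ℝ) + 1 ≤ n := by exact_mod_cast Nat.lt_succ_iff.1 h
      have h1 := ih r
      rw [corankStirling_succ_succ]
      cases r with
      | zero =>
        simp only [corankStirling_zero_right] at *
        push_cast at *
        linarith
      | succ s =>
        have h2 := mul_le_mul_of_nonneg_left (ih s) (sub_nonneg.2 hrn)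
        have hT := corankStirling_nonneg n s
        have h3 : (0 : ℝ) ≤ n * (n - 1) * corankStirling n s +
            n * (n - s) * corankStirling n s := by
          push_cast at hrn
          have : (0 : ℝ) ≤ s := s.cast_nonneg
          have : (0 : ℝ) ≤ n * (n - 1) := by nlinarith
          have : (0 : ℝ) ≤ n * (n - s) := by nlinarith
          positivity
        rw [corankStirling_succ_succ]
        push_cast at *
        linarith

/-- The error in approximating `(r + 1) S(n, n - r - 1)` by
`(n.choose 2 - (2 / 3) r (2 n - 1)) S(n, n - r)`. -/
noncomputable def corankDefect (n r : ℕ) : ℝ :=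
  ((r : ℝ) + 1) * corankStirling n (r + 1) -
    ((n : ℝ) * (n - 1) / 2 - r * ((2 / 3) * (2 * n - 1))) * corankStirling n r

lemma corankDefect_succ_succ (n r : ℕ) : corankDefect (n + 1) (r + 1) =
    corankDefect n (r + 1) + ((n : ℝ) - r - 2 / 3) * corankDefect n r +
      (17 * ((r : ℝ) + 1) * n - 8 * n - 12 * (r + 1) ^ 2 + 14 * (r + 1) - 2) / 9 *
        corankStirling n r := by
  simp only [corankDefect, corankStirling_succ_succ]
  push_cast
  ring

lemma corankDefect_zero_right (n : ℕ) : corankDefect n 0 = 0 := by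
  induction n with
  | zero => simp [corankDefect, corankStirling]
  | succ n ih =>
    simp only [corankDefect, corankStirling_succ_succ, corankStirling_zero_right] at *
    push_cast at *
    linarith

lemma corankDefect_eq_zero {n r : ℕ} (h : n ≤ r) : corankDefect n r = 0 := by
  rcases eq_or_ne r 0 with rfl | hr
  · exact corankDefect_zero_right n
  · rw [corankDefect, corankStirling_eq_zero hr h, corankStirling_eq_zero (by omega) (by omega)]
    ring

lemma corankDefect_nonneg (n r : ℕ) : 0 ≤ corankDefect n r := by
  induction n generalizing r with
  | zero => rw [corankDefect_eq_zero (Nat.zero_le r)]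
  | succ n ih =>
    rcases le_or_gt (n + 1) r with h | h
    · rw [corankDefect_eq_zero h]
    · cases r with
      | zero => rw [corankDefect_zero_right]
      | succ r =>
        have hrn : (r : ℝ) + 1 ≤ n := by exact_mod_cast Nat.lt_succ_iff.1 h
        have hr : (0 : ℝ) ≤ r := r.cast_nonneg
        rw [corankDefect_succ_succ]
        have h1 : 0 ≤ ((n : ℝ) - r - 2 / 3) * corankDefect n r :=
          mul_nonneg (by linarith) (ih r)
        have h2 : 0 ≤ (17 * ((r : ℝ) + 1) * n - 8 * n - 12 * (r + 1) ^ 2 + 14 * (r + 1) - 2) / 9 *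
            corankStirling n r :=
          mul_nonneg (by nlinarith) (corankStirling_nonneg n r)
        linarith [ih (r + 1)]

lemma corankDefect_succ_le (n r : ℕ) : corankDefect n (r + 1) ≤
    17 / 9 * ((r : ℝ) + 1) * ((n : ℝ) * (n - 1) / 2) * corankStirling n r := by
  induction n generalizing r with
  | zero => simp [corankDefect, corankStirling]
  | succ n ih =>
    rcases le_or_gt (n + 1) (r + 1) with h | h
    · rw [corankDefect_eq_zero h]
      push_cast
      have : (0 : ℝ) ≤ n := n.cast_nonneg
      exact mul_nonneg (by ring_nf; positivity) (corankStirling_nonneg _ _)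
    · have hrn : (r : ℝ) + 1 ≤ n := by exact_mod_cast Nat.lt_succ_iff.1 h
      have hr : (0 : ℝ) ≤ r := r.cast_nonneg
      have hT := corankStirling_nonneg n r
      have hG : (17 * ((r : ℝ) + 1) * n - 8 * n - 12 * (r + 1) ^ 2 + 14 * (r + 1) - 2) / 9 *
          corankStirling n r ≤ 17 / 9 * ((r : ℝ) + 1) * n * corankStirling n r :=
        mul_le_mul_of_nonneg_right (by nlinarith) hT
      rw [corankDefect_succ_succ]
      have h1 := ih r
      cases r with
      | zero =>
        simp only [corankDefect_zero_right, corankStirling_zero_right] at *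
        push_cast at *
        linarith
      | succ s =>
        have h2 := mul_le_mul_of_nonneg_left (ih s)
          (show (0 : ℝ) ≤ n - (s + 1 : ℕ) - 2 / 3 by linarith)
        have h4 := corankStirling_nonneg n s
        have h5 : ((n : ℝ) - (s + 1 : ℕ) - 2 / 3) * (17 / 9 * ((s : ℝ) + 1) *
              ((n : ℝ) * (n - 1) / 2) * corankStirling n s) ≤
            17 / 9 * ((s : ℝ) + 1 + 1) * (((n : ℝ) + 1) * n / 2) *
              ((n - s) * corankStirling n s) := by
          have hs : (0 : ℝ) ≤ s := s.cast_nonneg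
          push_cast at hrn
          have e1 : (n : ℝ) - (s + 1 : ℕ) - 2 / 3 ≤ n - s := by push_cast; linarith
          have e2 : (0 : ℝ) ≤ n - s := by linarith
          have e3 : 17 / 9 * ((s : ℝ) + 1) * ((n : ℝ) * (n - 1) / 2) ≤
            17 / 9 * ((s : ℝ) + 1 + 1) * (((n : ℝ) + 1) * n / 2) := by
            gcongr
            · nlinarith
            · linarith
            · linarith
            · linarith
            · linarith
          have e4 : 0 ≤ 17 / 9 * ((s : ℝ) + 1) * ((n : ℝ) * (n - 1) / 2) := by
            have : (0 : ℝ) ≤ n * (n - 1) := by nlinarith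
            positivity
          calc _ ≤ (n - s) * (17 / 9 * ((s : ℝ) + 1) *
              ((n : ℝ) * (n - 1) / 2) * corankStirling n s) := by gcongr
            _ ≤ (n - s) * (17 / 9 * ((s : ℝ) + 1 + 1) *
              (((n : ℝ) + 1) * n / 2) * corankStirling n s) := by gcongr
            _ = _ := by ring
        rw [corankStirling_succ_succ]
        push_cast at *
        linarith

lemma Real.exp_neg_le_one_sub_add_sq_half {y : ℝ} (hy : 0 ≤ y) :
    Real.exp (-y) ≤ 1 - y + y ^ 2 / 2 := by
  have h := Real.quadratic_le_exp_of_nonneg hy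
  rw [Real.exp_neg, inv_le_iff_one_le_mul₀ (Real.exp_pos y)]
  have h1 : 0 ≤ 1 - y + y ^ 2 / 2 := by nlinarith [sq_nonneg (y - 1)]
  nlinarith [mul_le_mul_of_nonneg_left h h1, sq_nonneg (y ^ 2)]

/-- A sequence satisfying `t (r + 1) ≈ (1 - r x) t r` up to `r ^ 2 x ^ 2` stays close to
`exp (-(r.choose 2) x)`. -/
lemma abs_sub_exp_le_of_recurrence {t : ℕ → ℝ} {x K : ℝ} (hx : 0 ≤ x) (hK : 0 ≤ K)
    (t_zero : t 0 = 1) (t_nonneg : ∀ r, 0 ≤ t r) (t_le_one : ∀ r, t r ≤ 1)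
    (lower : ∀ r : ℕ, t r * (1 - r * x) ≤ t (r + 1))
    (upper : ∀ r : ℕ, t (r + 1) ≤ t r * (1 - r * x) + r ^ 2 * x ^ 2) (r : ℕ) :
    |t r - Real.exp (-(r * (r - 1) / 2 * x))| ≤
      r * (r - 1) * (r - 3 / 2) * x ^ 2 + r * (r - 1) * (r - 2) * K := by
  induction r with
  | zero => simp [t_zero]
  | succ r ih =>
    have hr : (0 : ℝ) ≤ r := r.cast_nonneg
    have hrr : (0 : ℝ) ≤ r * (r - 1) := by
      cases r with
      | zero => simp
      | succ m => push_cast; ring_nf; positivity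
    have hy : 0 ≤ r * x := mul_nonneg hr hx
    set y := r * x with hy_def
    have hexp : Real.exp (-(((r + 1 : ℕ) : ℝ) * ((r + 1 : ℕ) - 1) / 2 * x)) =
        Real.exp (-(r * (r - 1) / 2 * x)) * Real.exp (-y) := by
      rw [← Real.exp_add]
      congr 1
      push_cast
      rw [hy_def]
      ring
    set e := Real.exp (-(r * (r - 1) / 2 * x))
    have h1 : 1 - y ≤ Real.exp (-y) := Real.one_sub_le_exp_neg y
    have h2 := Real.exp_neg_le_one_sub_add_sq_half hy
    have h3 : Real.exp (-y) ≤ 1 := Real.exp_le_one_iff.2 (by linarith)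
    have h4 := Real.exp_pos (-y)
    have hstep : |t (r + 1) - t r * Real.exp (-y)| ≤ y ^ 2 := by
      have h5 := mul_le_mul_of_nonneg_left h1 (t_nonneg r)
      have h6 := mul_le_mul_of_nonneg_left h2 (t_nonneg r)
      have h7 : t r * (y ^ 2 / 2) ≤ y ^ 2 := by nlinarith [t_le_one r, sq_nonneg y]
      have h8 := lower r
      have h9 := upper r
      rw [← mul_pow] at h9
      rw [abs_le]
      constructor <;> linarith
    have hprev : |(t r - e) * Real.exp (-y)| ≤ |t r - e| := by
      rw [abs_mul, abs_of_pos h4]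
      exact mul_le_of_le_one_right (abs_nonneg _) h3
    have htri := abs_add_le (t (r + 1) - t r * Real.exp (-y)) ((t r - e) * Real.exp (-y))
    rw [hexp, show t (r + 1) - e * Real.exp (-y) =
      t (r + 1) - t r * Real.exp (-y) + (t r - e) * Real.exp (-y) by ring]
    have hx2 := mul_nonneg hrr (sq_nonneg x)
    have hK2 := mul_nonneg hrr hK
    rw [hy_def, mul_pow] at hstep
    push_cast
    linarith

/-- The ratio of `S(n, n - r)` to its leading order `(n.choose 2) ^ r / r!`. -/
noncomputable def corankRatio (n r : ℕ) : ℝ :=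
  r.factorial * corankStirling n r / ((n : ℝ) * (n - 1) / 2) ^ r

lemma mul_sub_one_div_two_pos {n : ℕ} (hn : 2 ≤ n) : (0 : ℝ) < (n : ℝ) * (n - 1) / 2 := by
  have : (2 : ℝ) ≤ n := by exact_mod_cast hn
  have : (0 : ℝ) < n - 1 := by linarith
  positivity

lemma corankRatio_nonneg {n : ℕ} (hn : 2 ≤ n) (r : ℕ) : 0 ≤ corankRatio n r := by
  have := mul_sub_one_div_two_pos hn
  have := corankStirling_nonneg n r
  unfold corankRatio
  positivity

lemma corankRatio_succ_le {n : ℕ} (hn : 2 ≤ n) (r : ℕ) :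
    corankRatio n (r + 1) ≤ corankRatio n r := by
  have hN := mul_sub_one_div_two_pos hn
  unfold corankRatio
  rw [div_le_div_iff₀ (by positivity) (by positivity), Nat.factorial_succ, pow_succ]
  have h := mul_le_mul_of_nonneg_left (succ_mul_corankStirling_le n r)
    (show (0 : ℝ) ≤ r.factorial * ((n : ℝ) * (n - 1) / 2) ^ r by positivity)
  push_cast
  linarith

lemma corankRatio_le_one {n : ℕ} (hn : 2 ≤ n) (r : ℕ) : corankRatio n r ≤ 1 := by
  induction r with
  | zero => simp [corankRatio, corankStirling_zero_right]
  | succ r ih => exact (corankRatio_succ_le hn r).trans ih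

lemma corankRatio_succ {n : ℕ} (hn : 2 ≤ n) (r : ℕ) : corankRatio n (r + 1) =
    corankRatio n r * (1 - r * ((8 / 3) * (n - 1 / 2) / (n * (n - 1)))) +
      r.factorial * corankDefect n r / ((n : ℝ) * (n - 1) / 2) ^ (r + 1) := by
  have hN := mul_sub_one_div_two_pos hn
  have hx : (8 / 3) * ((n : ℝ) - 1 / 2) / (n * (n - 1)) =
      (2 / 3) * (2 * n - 1) / ((n : ℝ) * (n - 1) / 2) := by
    rw [div_eq_div_iff (by linarith) hN.ne']
    ring
  rw [hx]
  unfold corankRatio corankDefect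
  set N := (n : ℝ) * (n - 1) / 2
  rw [Nat.factorial_succ, pow_succ]
  push_cast
  field_simp
  ring

lemma factorial_mul_corankDefect_div_le {n : ℕ} (hn : 2 ≤ n) (r : ℕ) :
    r.factorial * corankDefect n r / ((n : ℝ) * (n - 1) / 2) ^ (r + 1) ≤
      r ^ 2 * ((8 / 3) * ((n : ℝ) - 1 / 2) / (n * (n - 1))) ^ 2 := by
  have hN := mul_sub_one_div_two_pos hn
  cases r with
  | zero => simp [corankDefect_zero_right]
  | succ r =>
    calc _ ≤ ((r + 1).factorial : ℝ) * (17 / 9 * ((r : ℝ) + 1) * ((n : ℝ) * (n - 1) / 2) *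
            corankStirling n r) / ((n : ℝ) * (n - 1) / 2) ^ (r + 1 + 1) := by
          gcongr
          exact corankDefect_succ_le n r
      _ = ((r : ℝ) + 1) ^ 2 * (17 / 9 / ((n : ℝ) * (n - 1) / 2)) * corankRatio n r := by
          unfold corankRatio
          set N := (n : ℝ) * (n - 1) / 2
          rw [Nat.factorial_succ, pow_succ, pow_succ]
          push_cast
          field_simp
      _ ≤ ((r : ℝ) + 1) ^ 2 * (17 / 9 / ((n : ℝ) * (n - 1) / 2)) * 1 := by
          gcongr
          exact corankRatio_le_one hn r
      _ ≤ _ := by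
          rw [mul_one]
          push_cast
          gcongr
          rw [div_pow, div_le_div_iff₀ hN (by nlinarith)]
          nlinarith [mul_pos hN hN]

lemma abs_corankRatio_sub_exp_le {n : ℕ} (hn : 2 ≤ n) {K : ℝ} (hK : 0 ≤ K) (r : ℕ) :
    |corankRatio n r - Real.exp (-(r * (r - 1) / 2 *
        ((8 / 3) * ((n : ℝ) - 1 / 2) / (n * (n - 1)))))| ≤
      r * (r - 1) * (r - 3 / 2) * ((8 / 3) * ((n : ℝ) - 1 / 2) / (n * (n - 1))) ^ 2 +
        r * (r - 1) * (r - 2) * K := by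
  have hN := mul_sub_one_div_two_pos hn
  have hn' : (2 : ℝ) ≤ n := by exact_mod_cast hn
  refine abs_sub_exp_le_of_recurrence (t := corankRatio n) ?_ hK ?_ (corankRatio_nonneg hn)
    (corankRatio_le_one hn) (fun r ↦ ?_) (fun r ↦ ?_) r
  · exact div_nonneg (by linarith) (by linarith)
  · simp [corankRatio, corankStirling_zero_right]
  · rw [corankRatio_succ hn]
    have := corankDefect_nonneg n r
    exact le_add_of_nonneg_right (by positivity)
  · rw [corankRatio_succ hn]
    gcongr
    exact factorial_mul_corankDefect_div_le hn r

/-- for `n ≥ 2`, `1 ≤ k ≤ n` and `r = n − k`, with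
`λ = (4/3)·C(r,2)·(n−1/2)/(n(n−1))`,
`c₁ᴬ = r(r−1)(r−3/2)·(64/(9n²))·((n−1/2)²/(n−1)²)` and
`c₂ᴬ = r(r−1)(r−2)·(40/(3n²))·((n(n−17/5)+17/5)/(n−1)²)`, the Stirling number of the second
kind satisfies
`(C(n,2)^r/r!)·e^{−2λ}(1 − e^{2λ}(c₁ᴬ+c₂ᴬ)) ≤ S(n,k) ≤ (C(n,2)^r/r!)·e^{−2λ}(1 + e^{2λ}(c₁ᴬ+c₂ᴬ))`. -/
theorem stirling_second_kind_bounds (n k : ℕ) (hn : 2 ≤ n) (hk1 : 1 ≤ k) (hkn : k ≤ n)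
    (r : ℕ) (hr : r = n - k)
    (lam c₁ c₂ : ℝ)
    (hlam : lam = (4/3) * (r.choose 2 : ℝ) * ((n : ℝ) - 1/2) / ((n : ℝ) * ((n : ℝ) - 1)))
    (hc₁ : c₁ = (r : ℝ) * ((r : ℝ) - 1) * ((r : ℝ) - 3/2) * (64 / (9 * (n : ℝ) ^ 2)) *
      (((n : ℝ) - 1/2) ^ 2 / ((n : ℝ) - 1) ^ 2))
    (hc₂ : c₂ = (r : ℝ) * ((r : ℝ) - 1) * ((r : ℝ) - 2) * (40 / (3 * (n : ℝ) ^ 2)) *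
      (((n : ℝ) * ((n : ℝ) - 17/5) + 17/5) / ((n : ℝ) - 1) ^ 2)) :
    (n.choose 2 : ℝ) ^ r / (r.factorial : ℝ) * Real.exp (-(2 * lam)) *
        (1 - Real.exp (2 * lam) * (c₁ + c₂)) ≤ (stirling2 n k : ℝ) ∧
    (stirling2 n k : ℝ) ≤ (n.choose 2 : ℝ) ^ r / (r.factorial : ℝ) * Real.exp (-(2 * lam)) *
        (1 + Real.exp (2 * lam) * (c₁ + c₂)) := by
  have hn' : (2 : ℝ) ≤ n := by exact_mod_cast hn
  have hN := mul_sub_one_div_two_pos hn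
  have hS : (stirling2 n k : ℝ) = (n.choose 2 : ℝ) ^ r / r.factorial * corankRatio n r := by
    obtain rfl : n = k + r := by omega
    rw [stirling2_eq_stirlingSecond, ← corankStirling_add_left k r hk1, Nat.cast_choose_two,
      corankRatio]
    field_simp
  have hexp : 2 * lam = r * (r - 1) / 2 * ((8 / 3) * ((n : ℝ) - 1 / 2) / (n * (n - 1))) := by
    rw [hlam, Nat.cast_choose_two]
    ring
  have hK : 0 ≤ 40 / (3 * (n : ℝ) ^ 2) *
      (((n : ℝ) * ((n : ℝ) - 17/5) + 17/5) / ((n : ℝ) - 1) ^ 2) := by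
    have : 0 ≤ (n : ℝ) * ((n : ℝ) - 17/5) + 17/5 := by nlinarith [sq_nonneg ((n : ℝ) - 17/10)]
    positivity
  have h := abs_corankRatio_sub_exp_le hn hK r
  have hc : r * (r - 1) * (r - 3 / 2) * ((8 / 3) * ((n : ℝ) - 1 / 2) / (n * (n - 1))) ^ 2 +
      r * (r - 1) * (r - 2) * (40 / (3 * (n : ℝ) ^ 2) *
        (((n : ℝ) * ((n : ℝ) - 17/5) + 17/5) / ((n : ℝ) - 1) ^ 2)) = c₁ + c₂ := by
    have h1 : (n : ℝ) - 1 ≠ 0 := by linarith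
    rw [hc₁, hc₂]
    field_simp
    ring
  rw [hc, ← hexp, abs_le] at h
  have hcancel : Real.exp (-(2 * lam)) * Real.exp (2 * lam) = 1 := by
    rw [← Real.exp_add, neg_add_cancel, Real.exp_zero]
  have hmul (c : ℝ) : Real.exp (-(2 * lam)) * (Real.exp (2 * lam) * c) = c := by
    rw [← mul_assoc, hcancel, one_mul]
  rw [hS, mul_assoc, mul_assoc, mul_sub _ 1,
    mul_add _ 1, mul_one, hmul]
  constructor <;> gcongr <;> linarith
end

section
/- Let t > 0 and let (r(n)) be a sequence of nonnegative integers with r(n)/√n → t as n → ∞. Place r = r(n) distinguishable rooks independently and uniformly at random on B_n. Then P(W_RR + W_CC = 0) → exp(−(4/3)t²) and P(W_CC = 0) → exp(−(2/3)t²) as n → ∞. -/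
open Finset Filter

/-- The triangular board `B_n = {(i,j) : 1 ≤ i < j ≤ n}`. -/
def board (n : ℕ) : Finset (ℕ × ℕ) :=
  (Finset.range (n + 1) ×ˢ Finset.range (n + 1)).filter fun p => 1 ≤ p.1 ∧ p.1 < p.2

/-- Probability of event `E` when `r` distinguishable rooks are placed independently and
uniformly at random on `B_n`; a placement is a function `Fin r → ℕ × ℕ`, rook `a` sitting
on the square `f a = (row, column)`. -/
noncomputable def rookProb (n r : ℕ) (E : (Fin r → ℕ × ℕ) → Prop) : ℝ :=
  ({f : Fin r → ℕ × ℕ | (∀ a, f a ∈ board n) ∧ E f}.ncard : ℝ) / ((board n).card : ℝ) ^ r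

/-- Number of (unordered) pairs of rooks lying in the same row. -/
def WRR (r : ℕ) (f : Fin r → ℕ × ℕ) : ℕ :=
  (Finset.univ.filter fun p : Fin r × Fin r => p.1 < p.2 ∧ (f p.1).1 = (f p.2).1).card

/-- Number of (unordered) pairs of rooks lying in the same column. -/
def WCC (r : ℕ) (f : Fin r → ℕ × ℕ) : ℕ :=
  (Finset.univ.filter fun p : Fin r × Fin r => p.1 < p.2 ∧ (f p.1).2 = (f p.2).2).card

open scoped BigOperators

/-- No two entries of `f` at distinct positions are related by `R`. -/
def Avoids {α : Type*} (R : α → α → Prop) {k : ℕ} (f : Fin k → α) : Prop :=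
  ∀ i j, i ≠ j → ¬ R (f i) (f j)

open Classical in
/-- Indicator of `Avoids R f`. -/
noncomputable def avoidInd {α : Type*} (R : α → α → Prop) {k : ℕ} (f : Fin k → α) : ℝ :=
  if Avoids R f then 1 else 0

open Classical in
/-- Indicator of the relation `R`. -/
noncomputable def relInd {α : Type*} (R : α → α → Prop) (x y : α) : ℝ := if R x y then 1 else 0

section Avoidance

variable {α : Type*} {R : α → α → Prop}

lemma avoidInd_nonneg {k : ℕ} (f : Fin k → α) : 0 ≤ avoidInd R f := by
  unfold avoidInd; split_ifs <;> norm_num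

lemma avoidInd_le_one {k : ℕ} (f : Fin k → α) : avoidInd R f ≤ 1 := by
  unfold avoidInd; split_ifs <;> norm_num

lemma relInd_nonneg (x y : α) : 0 ≤ relInd R x y := by
  unfold relInd; split_ifs <;> norm_num

lemma relInd_comm (hR : ∀ ⦃x y⦄, R x y → R y x) (x y : α) : relInd R x y = relInd R y x := by
  have h : R x y ↔ R y x := ⟨@hR _ _, @hR _ _⟩
  classical exact if_congr h rfl rfl

lemma relInd_mul_self (x y : α) : relInd R x y * relInd R x y = relInd R x y := by
  unfold relInd; split_ifs <;> norm_num

lemma avoids_insertNth_iff (hR : ∀ ⦃x y⦄, R x y → R y x) {k : ℕ} (p : Fin (k + 1)) (y : α)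
    (f : Fin k → α) :
    Avoids R (p.insertNth (α := fun _ => α) y f) ↔ Avoids R f ∧ ∀ i, ¬ R y (f i) := by
  simp only [Avoids, Fin.forall_iff_succAbove p, Fin.insertNth_apply_same,
    Fin.insertNth_apply_succAbove]
  constructor
  · rintro ⟨h1, h2⟩
    refine ⟨fun i j hij => (h2 i).2 j (by simpa using hij),
      fun i => h1.2 i (Fin.succAbove_ne p i).symm⟩
  · rintro ⟨h1, h2⟩
    refine ⟨⟨by simp, fun i _ => h2 i⟩,
      fun i => ⟨fun _ h => h2 i (hR h), fun j hij => h1 i j (by simpa using hij)⟩⟩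

lemma avoidInd_insertNth_le (hR : ∀ ⦃x y⦄, R x y → R y x) {k : ℕ} (p : Fin (k + 1)) (y : α)
    (f : Fin k → α) : avoidInd R (p.insertNth (α := fun _ => α) y f) ≤ avoidInd R f := by
  unfold avoidInd
  rw [avoids_insertNth_iff hR]
  split_ifs with h1 h2 <;> first | exact absurd h1.1 h2 | norm_num

lemma le_avoidInd_insertNth (hR : ∀ ⦃x y⦄, R x y → R y x) {k : ℕ} (p : Fin (k + 1)) (y : α)
    (f : Fin k → α) :
    avoidInd R f - ∑ i, avoidInd R f * relInd R y (f i) ≤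
      avoidInd R (p.insertNth (α := fun _ => α) y f) := by
  have h0 : ∀ i ∈ univ, 0 ≤ avoidInd R f * relInd R y (f i) :=
    fun i _ => mul_nonneg (avoidInd_nonneg f) (relInd_nonneg _ _)
  by_cases hy : ∃ i, R y (f i)
  · obtain ⟨i, hi⟩ := hy
    have := single_le_sum h0 (mem_univ i)
    have h1 : relInd R y (f i) = 1 := by simp [relInd, hi]
    rw [h1, mul_one] at this
    have := avoidInd_nonneg (R := R) (p.insertNth (α := fun _ => α) y f)
    linarith
  · push Not at hy
    have : avoidInd R (p.insertNth (α := fun _ => α) y f) = avoidInd R f := by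
      have h : Avoids R (p.insertNth (α := fun _ => α) y f) ↔ Avoids R f := by
        rw [avoids_insertNth_iff hR]
        exact and_iff_left hy
      classical exact if_congr h rfl rfl
    rw [this]
    linarith [sum_nonneg h0]

lemma sum_mul_succAbove {k : ℕ} (u : Fin (k + 1) → ℝ) (hu : ∀ i, u i * u i = u i) :
    ∑ i, ∑ j, u i * u (i.succAbove j) = (∑ i, u i) ^ 2 - ∑ i, u i := by
  have (i : Fin (k + 1)) : ∑ j, u i * u (i.succAbove j) = u i * (∑ l, u l) - u i := by
    rw [Fin.sum_univ_succAbove u i, mul_add, hu, mul_sum]; ring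
  simp only [this, sum_sub_distrib, ← sum_mul]
  ring

/-- Second-order Bonferroni bound for adding one entry. -/
lemma avoidInd_insertNth_le_second (hR : ∀ ⦃x y⦄, R x y → R y x) {k : ℕ} (p : Fin (k + 2)) (y : α)
    (f : Fin (k + 1) → α) :
    avoidInd R (p.insertNth (α := fun _ => α) y f) ≤
      avoidInd R f - ∑ i, avoidInd R f * relInd R y (f i) +
        ∑ i, ∑ j, relInd R y (f i) * relInd R y (f (i.succAbove j)) := by
  have hP : 0 ≤ ∑ i, ∑ j, relInd R y (f i) * relInd R y (f (i.succAbove j)) :=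
    sum_nonneg fun i _ => sum_nonneg fun j _ => mul_nonneg (relInd_nonneg _ _) (relInd_nonneg _ _)
  have hle := avoidInd_insertNth_le hR p y f
  by_cases hy : ∃ i, R y (f i)
  · have h0 : avoidInd R (p.insertNth (α := fun _ => α) y f) = 0 := by
      unfold avoidInd
      rw [avoids_insertNth_iff hR, if_neg]
      rintro ⟨-, h⟩
      exact hy.elim h
    rw [h0, ← mul_sum]
    have hA : avoidInd R f = 0 ∨ avoidInd R f = 1 := by
      unfold avoidInd; split_ifs <;> simp
    rcases hA with hA | hA
    · rw [hA]; linarith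
    · rw [hA, sum_mul_succAbove (fun i => relInd R y (f i)) fun i => relInd_mul_self _ _]
      nlinarith [sq_nonneg (∑ i, relInd R y (f i) - 1)]
  · push Not at hy
    have : ∀ i, relInd R y (f i) = 0 := fun i => by simp [relInd, hy]
    simpa [this] using hle

variable [Fintype α]

lemma expect_insertNth {k : ℕ} (p : Fin (k + 1)) (F : (Fin (k + 1) → α) → ℝ) :
    𝔼 f, F f = 𝔼 x, 𝔼 g : Fin k → α, F (p.insertNth (α := fun _ => α) x g) := by
  rw [← Fintype.expect_equiv (Fin.insertNthEquiv (fun _ => α) p)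
    (fun z => F (p.insertNth (α := fun _ => α) z.1 z.2)) F (fun _ => rfl), ← univ_product_univ,
    expect_product]

lemma expect_apply [Nonempty α] {k : ℕ} (i : Fin k) (h : α → ℝ) :
    𝔼 f : Fin k → α, h (f i) = 𝔼 x, h x := by
  cases k with
  | zero => exact i.elim0
  | succ k =>
    rw [expect_insertNth i]
    simp

variable (R)

/-- Probability that `k` independent uniform points are pairwise unrelated. -/
noncomputable def avoidProb (k : ℕ) : ℝ := 𝔼 f : Fin k → α, avoidInd R f

/-- Probability that a uniform point is related to `x`. -/
noncomputable def relDensityAt (x : α) : ℝ := 𝔼 y, relInd R x y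

/-- Probability that two independent uniform points are related. -/
noncomputable def relDensity : ℝ := 𝔼 x, relDensityAt R x

variable {R}

lemma relDensityAt_nonneg (x : α) : 0 ≤ relDensityAt R x :=
  expect_nonneg fun _ _ => relInd_nonneg _ _

lemma avoidProb_nonneg (k : ℕ) : 0 ≤ avoidProb R (α := α) k :=
  expect_nonneg fun _ _ => avoidInd_nonneg _

lemma relDensity_nonneg : 0 ≤ relDensity R (α := α) :=
  expect_nonneg fun _ _ => relDensityAt_nonneg _

lemma expect_avoidInd_mul_le (hR : ∀ ⦃x y⦄, R x y → R y x) {m : ℕ} (i : Fin (m + 1)) :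
    𝔼 f : Fin (m + 1) → α, avoidInd R f * relDensityAt R (f i) ≤
      avoidProb R (α := α) m * relDensity R := by
  rw [expect_insertNth i, relDensity, mul_expect]
  refine expect_le_expect fun x _ => ?_
  simp only [Fin.insertNth_apply_same, ← expect_mul]
  exact mul_le_mul_of_nonneg_right
    (expect_le_expect fun g _ => avoidInd_insertNth_le hR i x g) (relDensityAt_nonneg x)

variable [Nonempty α]

lemma avoidProb_le_one (k : ℕ) : avoidProb R (α := α) k ≤ 1 :=
  expect_le univ_nonempty fun _ _ => avoidInd_le_one _

lemma avoidProb_zero : avoidProb R (α := α) 0 = 1 := by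
  have : ∀ f : Fin 0 → α, avoidInd R f = 1 := fun f => by
    simp only [avoidInd, Avoids, IsEmpty.forall_iff, if_true]
  simp only [avoidProb, this, Fintype.expect_const]

lemma avoidProb_one : avoidProb R (α := α) 1 = 1 := by
  have : ∀ f : Fin 1 → α, avoidInd R f = 1 := fun f => by
    rw [avoidInd, if_pos]
    exact fun i j hij => (hij (Subsingleton.elim i j)).elim
  simp only [avoidProb, this, Fintype.expect_const]

lemma le_expect_avoidInd_mul (hR : ∀ ⦃x y⦄, R x y → R y x) {δ : ℝ}
    (hδ : ∀ x, relDensityAt R x ≤ δ) {m : ℕ} (i : Fin (m + 1)) :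
    (avoidProb R (α := α) m - m * δ) * relDensity R ≤
      𝔼 f : Fin (m + 1) → α, avoidInd R f * relDensityAt R (f i) := by
  rw [expect_insertNth i, relDensity, mul_expect]
  refine expect_le_expect fun x _ => ?_
  simp only [Fin.insertNth_apply_same, ← expect_mul]
  refine mul_le_mul_of_nonneg_right ?_ (relDensityAt_nonneg x)
  calc avoidProb R (α := α) m - m * δ
      ≤ avoidProb R (α := α) m - m * relDensityAt R x := by
        gcongr; exact hδ x
    _ = 𝔼 g : Fin m → α, (avoidInd R g - ∑ j, relInd R x (g j)) := by
        rw [expect_sub_distrib, expect_sum_comm]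
        simp only [expect_apply _ (relInd R x)]
        simp [avoidProb, relDensityAt]
    _ ≤ _ := by
        refine expect_le_expect fun g _ => le_trans ?_ (le_avoidInd_insertNth hR i x g)
        gcongr with j
        exact mul_le_of_le_one_left (relInd_nonneg _ _) (avoidInd_le_one g)

lemma relDensity_le {δ : ℝ} (hδ : ∀ x : α, relDensityAt R x ≤ δ) : relDensity R (α := α) ≤ δ :=
  expect_le univ_nonempty fun x _ => hδ x

lemma expect_avoidInd_sub (hR : ∀ ⦃x y⦄, R x y → R y x) (k : ℕ) :
    𝔼 y, 𝔼 f : Fin k → α, (avoidInd R f - ∑ i, avoidInd R f * relInd R y (f i)) =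
      avoidProb R (α := α) k - ∑ i, 𝔼 f : Fin k → α, avoidInd R f * relDensityAt R (f i) := by
  rw [expect_comm]
  simp only [expect_sub_distrib, Fintype.expect_const, expect_sum_comm, ← mul_expect, avoidProb]
  simp only [relDensityAt, relInd_comm hR _ (_ : α)]

lemma avoidProb_succ_le_self (hR : ∀ ⦃x y⦄, R x y → R y x) (k : ℕ) :
    avoidProb R (α := α) (k + 1) ≤ avoidProb R (α := α) k := by
  rw [avoidProb, expect_insertNth 0]
  exact expect_le univ_nonempty fun y _ =>
    expect_le_expect fun f _ => avoidInd_insertNth_le hR 0 y f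

lemma le_avoidProb_add_two (hR : ∀ ⦃x y⦄, R x y → R y x) (m : ℕ) :
    avoidProb R (α := α) (m + 1) - (m + 1) * relDensity R (α := α) * avoidProb R (α := α) m ≤
      avoidProb R (α := α) (m + 2) := by
  calc _ = avoidProb R (α := α) (m + 1) -
        ∑ i : Fin (m + 1), avoidProb R (α := α) m * relDensity R (α := α) := by
        simp; ring
    _ ≤ avoidProb R (α := α) (m + 1) -
        ∑ i, 𝔼 f : Fin (m + 1) → α, avoidInd R f * relDensityAt R (f i) := by
        gcongr with i
        exact expect_avoidInd_mul_le hR i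
    _ ≤ _ := by
        rw [← expect_avoidInd_sub hR, avoidProb, expect_insertNth 0]
        exact expect_le_expect fun y _ => expect_le_expect fun f _ => le_avoidInd_insertNth hR 0 y f

lemma expect_relInd_mul_relInd {m : ℕ} (y : α) (i : Fin (m + 1)) (j : Fin m) :
    𝔼 f : Fin (m + 1) → α, relInd R y (f i) * relInd R y (f (i.succAbove j)) =
      relDensityAt R y * relDensityAt R y := by
  rw [expect_insertNth i]
  simp only [Fin.insertNth_apply_same, Fin.insertNth_apply_succAbove, ← mul_expect,
    expect_apply _ (relInd R y), ← expect_mul]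
  rfl

lemma avoidProb_add_two_le (hR : ∀ ⦃x y⦄, R x y → R y x) {δ : ℝ}
    (hδ : ∀ x : α, relDensityAt R x ≤ δ) (m : ℕ) :
    avoidProb R (α := α) (m + 2) ≤ avoidProb R (α := α) (m + 1) -
      (m + 1) * relDensity R (α := α) * avoidProb R (α := α) m +
      2 * ((m + 1) * m * δ * relDensity R (α := α)) := by
  calc avoidProb R (α := α) (m + 2) ≤ 𝔼 y, 𝔼 f : Fin (m + 1) → α,
        (avoidInd R f - ∑ i, avoidInd R f * relInd R y (f i) +
          ∑ i, ∑ j, relInd R y (f i) * relInd R y (f (i.succAbove j))) := by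
        rw [avoidProb, expect_insertNth 0]
        exact expect_le_expect fun y _ => expect_le_expect fun f _ =>
          avoidInd_insertNth_le_second hR 0 y f
    _ = avoidProb R (α := α) (m + 1) -
        ∑ i, 𝔼 f : Fin (m + 1) → α, avoidInd R f * relDensityAt R (f i) +
        (m + 1) * m * 𝔼 y : α, relDensityAt R y * relDensityAt R y := by
        simp only [expect_add_distrib, expect_avoidInd_sub hR, expect_sum_comm,
          expect_relInd_mul_relInd]
        simp [mul_assoc]
    _ ≤ avoidProb R (α := α) (m + 1) -
        ∑ i : Fin (m + 1), (avoidProb R (α := α) m - m * δ) * relDensity R (α := α) +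
        (m + 1) * m * (δ * relDensity R (α := α)) := by
        gcongr with i
        · exact le_expect_avoidInd_mul hR hδ i
        · rw [relDensity, mul_expect]
          exact expect_le_expect fun y _ =>
            mul_le_mul_of_nonneg_right (hδ y) (relDensityAt_nonneg y)
    _ = _ := by simp; ring

lemma abs_avoidProb_succ_sub_le (hR : ∀ ⦃x y⦄, R x y → R y x) {δ : ℝ}
    (hδ : ∀ x : α, relDensityAt R x ≤ δ) (k : ℕ) :
    |avoidProb R (α := α) (k + 1) - (1 - k * relDensity R (α := α)) * avoidProb R (α := α) k| ≤
      3 * k ^ 2 * δ ^ 2 := by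
  obtain _ | m := k
  · simp [avoidProb_zero, avoidProb_one]
  have hs := relDensity_nonneg (R := R) (α := α)
  have hsδ := relDensity_le hδ
  have hlow := le_avoidProb_add_two hR (α := α) m
  have hup := avoidProb_add_two_le hR hδ m
  have hmono := avoidProb_succ_le_self hR (α := α) m
  have hdiff : avoidProb R (α := α) m - avoidProb R (α := α) (m + 1) ≤
      m * relDensity R (α := α) := by
    obtain _ | l := m
    · simp [avoidProb_zero, avoidProb_one]
    · have h1 := le_avoidProb_add_two hR (α := α) l
      have h2 := avoidProb_le_one (R := R) (α := α) l
      have : ((l : ℝ) + 1) * relDensity R (α := α) * avoidProb R (α := α) l ≤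
        (l + 1) * relDensity R (α := α) := mul_le_of_le_one_right (by positivity) h2
      push_cast
      linarith
  set s := relDensity R (α := α)
  set a := avoidProb R (α := α) m
  set b := avoidProb R (α := α) (m + 1)
  set c := avoidProb R (α := α) (m + 1 + 1)
  have hm : (0 : ℝ) ≤ m := m.cast_nonneg
  have hδ0 : 0 ≤ δ := hs.trans hsδ
  have h1 : (m + 1) * s * (a - b) ≤ (m + 1) * δ * ((m + 1) * δ) := by
    have : a - b ≤ (m + 1) * δ := by nlinarith
    gcongr
  have h2 : ((m : ℝ) + 1) * m * δ * s ≤ (m + 1) * (m + 1) * δ * δ := by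
    gcongr
    linarith
  have h3 : 0 ≤ (m + 1) * s * (a - b) := mul_nonneg (by positivity) (by linarith)
  have h4 : 0 ≤ ((m : ℝ) + 1) ^ 2 * δ ^ 2 := by positivity
  push_cast
  rw [abs_le]
  constructor <;> nlinarith

lemma abs_one_sub_sub_exp_neg_le {x : ℝ} (hx : 0 ≤ x) : |1 - x - Real.exp (-x)| ≤ x ^ 2 := by
  rcases le_total x 1 with h | h
  · have := Real.abs_exp_sub_one_sub_id_le (x := -x) (by rwa [abs_neg, abs_of_nonneg hx])
    rw [abs_sub_comm]
    rw [neg_sq] at this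
    convert this using 2
    ring
  · have h1 := Real.exp_pos (-x)
    have h2 : Real.exp (-x) ≤ 1 := Real.exp_le_one_iff.2 (by linarith)
    have h3 := Real.add_one_le_exp (-x)
    rw [abs_le]
    constructor <;> nlinarith

/-- Poisson-type approximation for the probability that uniform points are pairwise unrelated. -/
theorem abs_avoidProb_sub_exp_le (hR : ∀ ⦃x y⦄, R x y → R y x) {δ : ℝ}
    (hδ : ∀ x : α, relDensityAt R x ≤ δ) (r : ℕ) :
    |avoidProb R (α := α) r - Real.exp (-(relDensity R (α := α) * (r * (r - 1) / 2)))| ≤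
      4 * r ^ 3 * δ ^ 2 := by
  induction r with
  | zero => simp [avoidProb_zero]
  | succ k ih =>
    have hs := relDensity_nonneg (R := R) (α := α)
    have hsδ := relDensity_le hδ
    have hstep := abs_avoidProb_succ_sub_le hR hδ k
    have hq0 := avoidProb_nonneg (R := R) (α := α) k
    have hq1 := avoidProb_le_one (R := R) (α := α) k
    set s := relDensity R (α := α)
    set q := avoidProb R (α := α) k
    have hk : (0 : ℝ) ≤ k := k.cast_nonneg
    have he := abs_one_sub_sub_exp_neg_le (mul_nonneg hk hs)
    have he1 : Real.exp (-(k * s)) ≤ 1 := Real.exp_le_one_iff.2 (by nlinarith)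
    have hexp : Real.exp (-(s * (((k + 1 : ℕ) : ℝ) * ((k + 1 : ℕ) - 1) / 2))) =
        Real.exp (-(k * s)) * Real.exp (-(s * (k * (k - 1) / 2))) := by
      rw [← Real.exp_add]; congr 1; push_cast; ring
    rw [hexp]
    set E := Real.exp (-(k * s))
    set F := Real.exp (-(s * (k * (k - 1) / 2)))
    have hE : 0 ≤ E := (Real.exp_pos _).le
    calc |avoidProb R (α := α) (k + 1) - E * F|
        = |(avoidProb R (α := α) (k + 1) - (1 - k * s) * q) + (1 - k * s - E) * q
            + E * (q - F)| := by ring_nf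
      _ ≤ |avoidProb R (α := α) (k + 1) - (1 - k * s) * q| + |(1 - k * s - E) * q|
            + |E * (q - F)| := abs_add_three _ _ _
      _ ≤ 3 * k ^ 2 * δ ^ 2 + (k * δ) ^ 2 + 4 * k ^ 3 * δ ^ 2 := by
        gcongr
        · rw [abs_mul, abs_of_nonneg hq0]
          refine (mul_le_of_le_one_right (abs_nonneg _) hq1).trans (he.trans ?_)
          gcongr
        · rw [abs_mul, abs_of_nonneg hE]
          exact (mul_le_of_le_one_left (abs_nonneg _) he1).trans ih
      _ ≤ _ := by
        push_cast
        have : (0 : ℝ) ≤ (8 * k ^ 2 + 12 * k + 4) * δ ^ 2 := by positivity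
        linarith

end Avoidance

section Board

lemma mem_board {n : ℕ} {p : ℕ × ℕ} : p ∈ board n ↔ 1 ≤ p.1 ∧ p.1 < p.2 ∧ p.2 ≤ n := by
  simp only [board, mem_filter, mem_product, mem_range]
  omega

lemma board_zero : board 0 = ∅ := by
  ext p
  simp only [mem_board, notMem_empty, iff_false]
  omega

lemma sum_board_succ (n : ℕ) (g : ℕ × ℕ → ℝ) :
    ∑ p ∈ board (n + 1), g p = ∑ p ∈ board n, g p + ∑ i ∈ range n, g (i + 1, n + 1) := by
  have hinj : Function.Injective fun i : ℕ => (i + 1, n + 1) := fun a b h => by simpa using h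
  have hdisj : Disjoint (board n) ((range n).map ⟨_, hinj⟩) := by
    rw [Finset.disjoint_left]
    intro p hp hq
    simp only [Finset.mem_map, mem_range, Function.Embedding.coeFn_mk] at hq
    obtain ⟨i, -, rfl⟩ := hq
    have := mem_board.1 hp
    simp at this
  have hunion : board (n + 1) = board n ∪ (range n).map ⟨_, hinj⟩ := by
    ext ⟨a, b⟩
    simp only [mem_union, mem_board, Finset.mem_map, mem_range, Function.Embedding.coeFn_mk,
      Prod.mk.injEq]
    constructor
    · intro h
      rcases Nat.lt_or_ge n b with hb | hb
      · exact Or.inr ⟨a - 1, by omega, by omega, by omega⟩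
      · exact Or.inl (by omega)
    · rintro (h | ⟨i, hi, rfl, rfl⟩) <;> omega
  rw [hunion, sum_union hdisj, sum_map]
  rfl

lemma card_board (n : ℕ) : ((board n).card : ℝ) = n * (n - 1) / 2 := by
  rw [← mul_one ((board n).card : ℝ), ← nsmul_eq_mul, ← sum_const]
  induction n with
  | zero => simp [board_zero]
  | succ n ih =>
    rw [sum_board_succ, ih]
    simp
    ring

lemma sum_board_col (n : ℕ) :
    ∑ p ∈ board n, ((p.2 : ℝ) - 1) = (n - 1) * n * (2 * n - 1) / 6 := by
  induction n with
  | zero => simp [board_zero]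
  | succ n ih =>
    rw [sum_board_succ, ih]
    simp
    ring

lemma sum_board_row (n : ℕ) :
    ∑ p ∈ board n, ((n : ℝ) - p.1) = (n - 1) * n * (2 * n - 1) / 6 := by
  induction n with
  | zero => simp [board_zero]
  | succ n ih =>
    have h1 : ∑ p ∈ board n, (((n + 1 : ℕ) : ℝ) - p.1) =
        ∑ p ∈ board n, ((n : ℝ) - p.1) + (board n).card := by
      rw [card_eq_sum_ones, Nat.cast_sum, ← sum_add_distrib]
      refine sum_congr rfl fun p _ => ?_
      push_cast
      ring
    have h2 : ∑ i ∈ range n, (((n + 1 : ℕ) : ℝ) - ((i + 1 : ℕ) : ℝ)) = n * (n + 1) / 2 := by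
      have : ∀ m : ℕ, ∑ i ∈ range m, (i : ℝ) = m * (m - 1) / 2 := fun m => by
        induction m with
        | zero => simp
        | succ m ih => rw [sum_range_succ, ih]; push_cast; ring
      simp [this]
      ring
    rw [sum_board_succ, h1, h2, ih, card_board]
    push_cast
    ring

/-- Two squares in the same column. -/
def SameCol (x y : ℕ × ℕ) : Prop := x.2 = y.2

/-- Two squares in the same row or in the same column. -/
def SameLine (x y : ℕ × ℕ) : Prop := x.1 = y.1 ∨ x.2 = y.2

instance : DecidableRel SameCol := fun x y => inferInstanceAs (Decidable (x.2 = y.2))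

instance : DecidableRel SameLine := fun x y =>
  inferInstanceAs (Decidable (x.1 = y.1 ∨ x.2 = y.2))

lemma card_board_filter_sameCol {n : ℕ} {x : ℕ × ℕ} (hx : x ∈ board n) :
    (((board n).filter fun y => SameCol x y).card : ℝ) = x.2 - 1 := by
  have h := mem_board.1 hx
  have : ((board n).filter fun y => SameCol x y) = Ico 1 x.2 ×ˢ {x.2} := by
    ext ⟨a, b⟩
    simp only [mem_filter, mem_board, mem_product, mem_Ico, mem_singleton]
    simp only [SameCol]
    omega
  rw [this, card_product, Nat.card_Ico, card_singleton, mul_one, Nat.cast_sub (by omega)]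
  simp

lemma card_board_filter_row {n : ℕ} {x : ℕ × ℕ} (hx : x ∈ board n) :
    (((board n).filter fun y => x.1 = y.1).card : ℝ) = n - x.1 := by
  have h := mem_board.1 hx
  have : ((board n).filter fun y => x.1 = y.1) = {x.1} ×ˢ Ioc x.1 n := by
    ext ⟨a, b⟩
    simp only [mem_filter, mem_board, mem_product, mem_Ioc, mem_singleton]
    omega
  rw [this, card_product, Nat.card_Ioc, card_singleton, one_mul, Nat.cast_sub (by omega)]

lemma card_board_filter_sameLine {n : ℕ} {x : ℕ × ℕ} (hx : x ∈ board n) :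
    (((board n).filter fun y => SameLine x y).card : ℝ) =
      ((n : ℝ) - x.1) + (x.2 - 1) - 1 := by
  have hinter : ((board n).filter fun y => x.1 = y.1) ∩ ((board n).filter fun y => SameCol x y) =
      {x} := by
    ext y
    simp only [mem_inter, mem_filter, mem_singleton, Prod.ext_iff]
    constructor
    · rintro ⟨⟨-, h1⟩, -, h2⟩
      exact ⟨h1.symm, h2.symm⟩
    · rintro ⟨h1, h2⟩
      have : y = x := Prod.ext h1 h2
      subst this
      exact ⟨⟨hx, rfl⟩, hx, rfl⟩
  have := card_union_add_card_inter ((board n).filter fun y => x.1 = y.1)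
    ((board n).filter fun y => SameCol x y)
  rw [hinter, card_singleton, ← filter_or] at this
  change #((board n).filter fun y => SameLine x y) + 1 = _ at this
  rw [← card_board_filter_row hx, ← card_board_filter_sameCol hx]
  have h := congrArg (Nat.cast : ℕ → ℝ) this
  push_cast at h
  linarith

/-- The restriction to the squares of `B_n` of a relation on pairs of integers. -/
def boardRel (R : ℕ × ℕ → ℕ × ℕ → Prop) (n : ℕ) (x y : board n) : Prop := R x y

lemma rookProb_avoids (R : ℕ × ℕ → ℕ × ℕ → Prop) (n r : ℕ) :
    rookProb n r (fun f => Avoids R f) = avoidProb (boardRel R n) r := by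
  classical
  have himage : {f : Fin r → ℕ × ℕ | (∀ a, f a ∈ board n) ∧ Avoids R f} =
      (fun (g : Fin r → board n) a => (g a : ℕ × ℕ)) '' {g | Avoids (boardRel R n) g} := by
    ext f
    constructor
    · rintro ⟨h1, h2⟩
      exact ⟨fun a => ⟨f a, h1 a⟩, h2, rfl⟩
    · rintro ⟨g, hg, rfl⟩
      exact ⟨fun a => (g a).2, hg⟩
  have hinj : Function.Injective fun (g : Fin r → board n) a => (g a : ℕ × ℕ) :=
    fun g g' h => funext fun a => Subtype.ext (congrFun h a)
  rw [rookProb, himage, Set.ncard_image_of_injective _ hinj, avoidProb,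
    Fintype.expect_eq_sum_div_card]
  simp [avoidInd, Set.ncard_eq_toFinset_card']

lemma relDensityAt_boardRel (R : ℕ × ℕ → ℕ × ℕ → Prop) [DecidableRel R] {n : ℕ} (x : board n) :
    relDensityAt (boardRel R n) x = ((board n).filter fun y => R x y).card / (board n).card := by
  classical
  rw [relDensityAt, Fintype.expect_eq_sum_div_card, Fintype.card_coe, card_filter, Nat.cast_sum,
    ← sum_coe_sort (board n)]
  congr 1
  refine sum_congr rfl fun y _ => ?_
  by_cases h : R x y <;> simp [relInd, boardRel, h]

lemma relDensity_boardRel (R : ℕ × ℕ → ℕ × ℕ → Prop) [DecidableRel R] (n : ℕ) :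
    relDensity (boardRel R n) =
      (∑ x ∈ board n, (((board n).filter fun y => R x y).card : ℝ)) / (board n).card ^ 2 := by
  simp only [relDensity, relDensityAt_boardRel]
  rw [Fintype.expect_eq_sum_div_card, Fintype.card_coe, ← sum_div, div_div, ← sq,
    sum_coe_sort (board n) fun x => (((board n).filter fun y => R x y).card : ℝ)]

lemma WCC_eq_zero_iff {r : ℕ} (f : Fin r → ℕ × ℕ) : WCC r f = 0 ↔ Avoids SameCol f := by
  simp only [WCC, card_eq_zero, filter_eq_empty_iff, mem_univ, true_imp_iff, not_and,
    Prod.forall, Avoids, SameCol]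
  refine ⟨fun h i j hij => ?_, fun h i j hij => h i j hij.ne⟩
  rcases lt_or_gt_of_ne hij with hlt | hlt
  · exact h i j hlt
  · exact fun he => h j i hlt he.symm

lemma WRR_add_WCC_eq_zero_iff {r : ℕ} (f : Fin r → ℕ × ℕ) :
    WRR r f + WCC r f = 0 ↔ Avoids SameLine f := by
  simp only [Nat.add_eq_zero_iff, WRR, WCC, card_eq_zero, filter_eq_empty_iff, mem_univ,
    true_imp_iff, not_and, Prod.forall, Avoids, SameLine, not_or]
  refine ⟨fun h i j hij => ?_, fun h => ⟨fun i j hij => (h i j hij.ne).1,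
    fun i j hij => (h i j hij.ne).2⟩⟩
  rcases lt_or_gt_of_ne hij with hlt | hlt
  · exact ⟨h.1 i j hlt, h.2 i j hlt⟩
  · exact ⟨fun he => h.1 j i hlt he.symm, fun he => h.2 j i hlt he.symm⟩

lemma relDensity_sameCol {n : ℕ} (hn : 2 ≤ n) :
    n * relDensity (boardRel SameCol n) = 4 / 3 + 2 / 3 * ((n : ℝ) - 1)⁻¹ := by
  have h2 : (2 : ℝ) ≤ n := by exact_mod_cast hn
  have h1 : (n : ℝ) - 1 ≠ 0 := by linarith
  rw [relDensity_boardRel, sum_congr rfl fun x hx => card_board_filter_sameCol hx, sum_board_col,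
    card_board]
  field_simp
  ring

lemma relDensity_sameLine {n : ℕ} (hn : 2 ≤ n) :
    n * relDensity (boardRel SameLine n) = 8 / 3 - 2 / 3 * ((n : ℝ) - 1)⁻¹ := by
  have h2 : (2 : ℝ) ≤ n := by exact_mod_cast hn
  have h1 : (n : ℝ) - 1 ≠ 0 := by linarith
  rw [relDensity_boardRel, sum_congr rfl fun x hx => card_board_filter_sameLine hx,
    sum_sub_distrib, sum_add_distrib, sum_board_col, sum_board_row, sum_const, nsmul_one,
    card_board]
  field_simp
  ring

lemma relDensityAt_sameLine_le {n : ℕ} (hn : 2 ≤ n) (x : board n) :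
    relDensityAt (boardRel SameLine n) x ≤ 4 * ((n : ℝ) - 1)⁻¹ := by
  have h2 : (2 : ℝ) ≤ n := by exact_mod_cast hn
  have h1 : 0 < (n : ℝ) - 1 := by linarith
  have hx : (x.1.2 : ℝ) ≤ n := by exact_mod_cast (mem_board.1 x.2).2.2
  have hx' : (0 : ℝ) ≤ x.1.1 := Nat.cast_nonneg _
  rw [relDensityAt_boardRel]
  refine (div_le_div_of_nonneg_right (c := ((board n).card : ℝ)) (b := 2 * (n : ℝ))
    ((card_board_filter_sameLine x.2).trans_le (by linarith)) (Nat.cast_nonneg _)).trans_eq ?_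
  rw [card_board]
  field_simp
  norm_num

lemma relDensityAt_sameCol_le {n : ℕ} (hn : 2 ≤ n) (x : board n) :
    relDensityAt (boardRel SameCol n) x ≤ 4 * ((n : ℝ) - 1)⁻¹ := by
  refine le_trans ?_ (relDensityAt_sameLine_le hn x)
  rw [relDensityAt_boardRel, relDensityAt_boardRel]
  gcongr
  exact fun h => Or.inr h

lemma tendsto_of_abs_sub_exp_le {t L : ℝ} {r : ℕ → ℕ} {q s : ℕ → ℝ}
    (hlim : Tendsto (fun n : ℕ => (r n : ℝ) / Real.sqrt n) atTop (nhds t))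
    (hs : Tendsto (fun n : ℕ => n * s n) atTop (nhds L))
    (hq : ∀ n ≥ 2, |q n - Real.exp (-(s n * (r n * (r n - 1) / 2)))| ≤
      4 * (r n : ℝ) ^ 3 * (4 * ((n : ℝ) - 1)⁻¹) ^ 2) :
    Tendsto q atTop (nhds (Real.exp (-(L * t ^ 2 / 2)))) := by
  have hsqrt : Tendsto (fun n : ℕ => (Real.sqrt n)⁻¹) atTop (nhds 0) :=
    tendsto_inv_atTop_zero.comp (Real.tendsto_sqrt_atTop.comp tendsto_natCast_atTop_atTop)
  have hu : Tendsto (fun n : ℕ => ((n : ℝ) - 1)⁻¹) atTop (nhds 0) :=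
    tendsto_inv_atTop_zero.comp (tendsto_atTop_add_const_right _ (-1) tendsto_natCast_atTop_atTop)
  have hexp : Tendsto (fun n : ℕ => Real.exp (-(s n * (r n * (r n - 1) / 2)))) atTop
      (nhds (Real.exp (-(L * t ^ 2 / 2)))) := by
    refine (Real.continuous_exp.tendsto _).comp (Tendsto.neg ?_)
    have := (hs.mul (hlim.mul (hlim.sub hsqrt))).div_const 2
    rw [sub_zero, ← sq] at this
    refine this.congr' ?_
    filter_upwards [eventually_ge_atTop 1] with n hn
    have hn' : (0 : ℝ) < n := by exact_mod_cast hn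
    have h0 : Real.sqrt n ≠ 0 := (Real.sqrt_pos.2 hn').ne'
    have h1 : (n : ℝ) = Real.sqrt n ^ 2 := (Real.sq_sqrt hn'.le).symm
    generalize Real.sqrt n = w at *
    rw [h1]
    field_simp
  have herr : Tendsto (fun n : ℕ => 4 * (r n : ℝ) ^ 3 * (4 * ((n : ℝ) - 1)⁻¹) ^ 2) atTop
      (nhds 0) := by
    have := (((hlim.pow 3).const_mul 64).mul ((hu.const_add 1).pow 2)).mul hsqrt
    rw [mul_zero] at this
    refine this.congr' ?_
    filter_upwards [eventually_ge_atTop 2] with n hn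
    have hn' : (2 : ℝ) ≤ n := by exact_mod_cast hn
    have h0 : Real.sqrt n ≠ 0 := (Real.sqrt_pos.2 (by linarith)).ne'
    have h1 : (n : ℝ) = Real.sqrt n ^ 2 := (Real.sq_sqrt (by linarith)).symm
    have h2 : (n : ℝ) - 1 ≠ 0 := by linarith
    generalize Real.sqrt n = w at *
    rw [h1] at h2 ⊢
    field_simp
    ring
  have hdiff : Tendsto (fun n => q n - Real.exp (-(s n * (r n * (r n - 1) / 2)))) atTop
      (nhds 0) :=
    squeeze_zero_norm' ((eventually_ge_atTop 2).mono fun n hn => hq n hn) herr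
  simpa using hdiff.add hexp

lemma nonempty_board {n : ℕ} (hn : 2 ≤ n) : Nonempty (board n) :=
  ⟨⟨(1, 2), mem_board.2 ⟨le_rfl, by norm_num, hn⟩⟩⟩

end Board


/-- if `r(n)/√n → t > 0` and `r(n)` rooks are placed independently and uniformly
at random on `B_n`, then `P(W_RR + W_CC = 0) → exp(−(4/3)t²)` and
`P(W_CC = 0) → exp(−(2/3)t²)` as `n → ∞`. -/
theorem no_attack_probability_limits (t : ℝ) (ht : 0 < t) (r : ℕ → ℕ)
    (hlim : Tendsto (fun n : ℕ => (r n : ℝ) / Real.sqrt n) atTop (nhds t)) :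
    Tendsto (fun n : ℕ => rookProb n (r n) (fun f => WRR (r n) f + WCC (r n) f = 0))
        atTop (nhds (Real.exp (-(4/3) * t ^ 2))) ∧
    Tendsto (fun n : ℕ => rookProb n (r n) (fun f => WCC (r n) f = 0))
        atTop (nhds (Real.exp (-(2/3) * t ^ 2))) := by
  have hu : Tendsto (fun n : ℕ => ((n : ℝ) - 1)⁻¹) atTop (nhds 0) :=
    tendsto_inv_atTop_zero.comp (tendsto_atTop_add_const_right _ (-1) tendsto_natCast_atTop_atTop)
  simp only [WRR_add_WCC_eq_zero_iff, WCC_eq_zero_iff, rookProb_avoids]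
  constructor
  · have hs : Tendsto (fun n : ℕ => n * relDensity (boardRel SameLine n)) atTop (nhds (8 / 3)) := by
      have := (hu.const_mul (2 / 3)).const_sub (8 / 3)
      rw [mul_zero, sub_zero] at this
      exact this.congr' ((eventually_ge_atTop 2).mono fun n hn => (relDensity_sameLine hn).symm)
    convert tendsto_of_abs_sub_exp_le hlim hs fun n hn => ?_ using 3
    · ring
    · have := nonempty_board hn
      exact abs_avoidProb_sub_exp_le (fun _ _ h => h.imp Eq.symm Eq.symm)
        (relDensityAt_sameLine_le hn) (r n)
  · have hs : Tendsto (fun n : ℕ => n * relDensity (boardRel SameCol n)) atTop (nhds (4 / 3)) := by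
      have := (hu.const_mul (2 / 3)).const_add (4 / 3)
      rw [mul_zero, add_zero] at this
      exact this.congr' ((eventually_ge_atTop 2).mono fun n hn => (relDensity_sameCol hn).symm)
    convert tendsto_of_abs_sub_exp_le hlim hs fun n hn => ?_ using 3
    · ring
    · have := nonempty_board hn
      exact abs_avoidProb_sub_exp_le (fun _ _ h => Eq.symm h) (relDensityAt_sameCol_le hn) (r n)
end

section
/- Let t > 0 and let (k(n)) be a sequence of positive integers with (n − k(n))/√n → t as n → ∞, and write r = n − k(n). Then the unsigned Stirling number of the first kind satisfies s(n, k(n)) ~ (1/r!) · binomial(n,2)^r · exp(−(2/3)t²) as n → ∞, i.e. the ratio of the two sides tends to 1. -/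
open Finset Filter

/-- `s(n,k)`, the unsigned Stirling number of the first kind: the number of permutations of a
set of size `n` having exactly `k` cycles (fixed points count as cycles). -/
noncomputable def stirling1 (n k : ℕ) : ℕ :=
  Nat.card {σ : Equiv.Perm (Fin n) // numCycles σ = k}

/-- Splitting a point off its cycle raises the number of cycles, fixed points included, by one. -/
theorem card_cycleType_swap_mul_add_card_support {α : Type*} [Fintype α] [DecidableEq α]
    (g : Equiv.Perm α) {a : α} (ha : g a ≠ a) :
    (Equiv.swap a (g a) * g).cycleType.card + g.support.card =
      g.cycleType.card + (Equiv.swap a (g a) * g).support.card + 1 := by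
  set c := g.cycleOf a with hc
  have hca : c a = g a := g.cycleOf_apply_self a
  have hcyc : c.IsCycle := Equiv.Perm.isCycle_cycleOf g ha
  have hmem : c ∈ g.cycleFactorsFinset :=
    Equiv.Perm.cycleOf_mem_cycleFactorsFinset_iff.2 (Equiv.Perm.mem_support.2 ha)
  set d := g * c⁻¹ with hd
  have hdisj : c.Disjoint d := (Equiv.Perm.disjoint_mul_inv_of_mem_cycleFactorsFinset hmem).symm
  have hg : g = c * d := by rw [hdisj.commute.eq, hd, inv_mul_cancel_right]
  have hca' : c a ≠ a := hca ▸ ha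
  have hs : Equiv.swap a (g a) * g = Equiv.swap a (c a) * c * d := by
    rw [hca, mul_assoc, ← hg]
  have hdisj' : (Equiv.swap a (c a) * c).Disjoint d :=
    by
    refine Equiv.Perm.disjoint_iff_disjoint_support.2
      (hdisj.disjoint_support.mono_left fun x hx => Equiv.Perm.mem_support.2 ?_)
    exact (Equiv.Perm.ne_and_ne_of_swap_mul_apply_ne_self (Equiv.Perm.mem_support.1 hx)).1
  rw [hs, hdisj'.cycleType_mul, hdisj'.card_support_mul]
  have h1 : g.cycleType = c.cycleType + d.cycleType := by rw [← hdisj.cycleType_mul, ← hg]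
  have h2 : g.support.card = c.support.card + d.support.card := by
    rw [← hdisj.card_support_mul, ← hg]
  rw [h1, h2, Multiset.card_add, Multiset.card_add, hcyc.cycleType]
  by_cases h : c (c a) = a
  · have hsw := hcyc.eq_swap_of_apply_apply_eq_self hca' h
    have hone : Equiv.swap a (c a) * c = 1 := by
      conv_lhs => rw [hsw]
      simp
    have hcard : c.support.card = 2 := by
      rw [hsw]; exact Equiv.Perm.card_support_swap hca'.symm
    rw [hone, hcard]
    simp
    omega
  · rw [(hcyc.swap_mul hca' h).cycleType, Equiv.Perm.support_swap_mul_eq c a h,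
      ← Finset.card_sdiff_add_card_inter c.support {a},
      Finset.inter_singleton_of_mem (Equiv.Perm.mem_support.2 hca')]
    simp
    omega

theorem numCycles_add_card_support {n : ℕ} (σ : Equiv.Perm (Fin n)) :
    numCycles σ + σ.support.card = n + σ.cycleType.card := by
  have h := Finset.card_filter_add_card_filter_not (s := (univ : Finset (Fin n)))
    (fun x => σ x = x)
  rw [Finset.card_univ, Fintype.card_fin] at h
  have hs : σ.support = univ.filter fun x => ¬ σ x = x := by
    ext x; simp
  rw [numCycles, hs]
  omega

theorem cycleType_decomposeFin_symm_zero {n : ℕ} (e : Equiv.Perm (Fin n)) :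
    (Equiv.Perm.decomposeFin.symm (0, e)).cycleType = e.cycleType := by
  have h : Equiv.Perm.decomposeFin.symm (0, e) =
      e.extendDomain (finSuccAboveEquiv (0 : Fin (n + 1))) := by
    ext x
    refine Fin.cases ?_ (fun i => ?_) x
    · rw [Equiv.Perm.extendDomain_apply_not_subtype _ _ (by simp)]
      simp
    · have := Equiv.Perm.extendDomain_apply_image e (finSuccAboveEquiv (0 : Fin (n + 1))) i
      simp only [finSuccAboveEquiv_apply, Fin.zero_succAbove] at this
      simp [this]
  rw [h, Equiv.Perm.cycleType_extendDomain]

theorem numCycles_decomposeFin_symm {n : ℕ} (p : Fin (n + 1)) (e : Equiv.Perm (Fin n)) :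
    numCycles (Equiv.Perm.decomposeFin.symm (p, e)) = numCycles e + if p = 0 then 1 else 0 := by
  have h0 := numCycles_add_card_support (Equiv.Perm.decomposeFin.symm (0, e))
  have he := numCycles_add_card_support e
  rw [← Equiv.Perm.sum_cycleType, cycleType_decomposeFin_symm_zero] at h0
  rw [← Equiv.Perm.sum_cycleType] at he
  split_ifs with hp
  · rw [hp]; omega
  · set g := Equiv.Perm.decomposeFin.symm (p, e) with hg
    have hg0 : g 0 = p := Equiv.Perm.decomposeFin_symm_apply_zero p e
    have hs : Equiv.swap 0 (g 0) * g = Equiv.Perm.decomposeFin.symm (0, e) := by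
      ext x
      refine Fin.cases ?_ (fun i => ?_) x
      · simp [hg0]
      · rw [Equiv.Perm.mul_apply, hg0, hg, Equiv.Perm.decomposeFin_symm_apply_succ]
        simp
    have h1 := card_cycleType_swap_mul_add_card_support g (a := 0) (by rw [hg0]; exact hp)
    have h2 := numCycles_add_card_support g
    rw [hs, ← Equiv.Perm.sum_cycleType (Equiv.Perm.decomposeFin.symm (0, e)),
      cycleType_decomposeFin_symm_zero] at h1
    omega

theorem stirling1_eq_sum (n k : ℕ) :
    stirling1 n k = ∑ σ : Equiv.Perm (Fin n), if numCycles σ = k then 1 else 0 := by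
  rw [stirling1, Nat.card_eq_fintype_card, Fintype.card_subtype, Finset.card_filter]

theorem stirling1_succ (n k : ℕ) :
    stirling1 (n + 1) k =
      n * stirling1 n k + ∑ σ : Equiv.Perm (Fin n), if numCycles σ + 1 = k then 1 else 0 := by
  rw [stirling1_eq_sum, ← Equiv.sum_comp Equiv.Perm.decomposeFin.symm, Fintype.sum_prod_type,
    Fin.sum_univ_succ, add_comm]
  simp only [numCycles_decomposeFin_symm, Fin.succ_ne_zero, if_true, if_false, add_zero,
    ← stirling1_eq_sum]
  simp

/-- The combinatorial definition agrees with the recursive one. -/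
theorem stirling1_eq_stirlingFirst (n k : ℕ) : stirling1 n k = Nat.stirlingFirst n k := by
  induction n generalizing k with
  | zero =>
    rw [stirling1_eq_sum]
    cases k <;> simp [numCycles, Nat.stirlingFirst]
  | succ n ih =>
    rw [stirling1_succ]
    cases k with
    | zero =>
      rw [ih]
      cases n <;> simp [Nat.stirlingFirst]
    | succ k =>
      simp only [add_left_inj, ← stirling1_eq_sum, ih, Nat.stirlingFirst_succ_succ]

/-- The elementary symmetric polynomial of degree `r` in `a 0, …, a (n - 1)`, extended by zero to
negative degrees. -/
noncomputable def elemSymm (a : ℕ → ℝ) : ℕ → ℤ → ℝ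
  | 0, r => if r = 0 then 1 else 0
  | n + 1, r => elemSymm a n r + a n * elemSymm a n (r - 1)

theorem elemSymm_of_lt (a : ℕ → ℝ) {n : ℕ} {r : ℤ} (h : (n : ℤ) < r) : elemSymm a n r = 0 := by
  induction n generalizing r with
  | zero => simp [elemSymm]; omega
  | succ n ih =>
    push_cast at h
    rw [elemSymm, ih (by omega), ih (by omega)]
    simp

theorem elemSymm_of_neg (a : ℕ → ℝ) (n : ℕ) {r : ℤ} (h : r < 0) : elemSymm a n r = 0 := by
  induction n generalizing r with
  | zero => simp [elemSymm]; omega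
  | succ n ih =>
    rw [elemSymm, ih h, ih (by omega)]
    simp

theorem elemSymm_zero_right (a : ℕ → ℝ) (n : ℕ) : elemSymm a n 0 = 1 := by
  induction n with
  | zero => simp [elemSymm]
  | succ n ih => rw [elemSymm, ih, elemSymm_of_neg a n (by norm_num)]; simp

theorem elemSymm_nonneg {a : ℕ → ℝ} (ha : ∀ i, 0 ≤ a i) (n : ℕ) (r : ℤ) :
    0 ≤ elemSymm a n r := by
  induction n generalizing r with
  | zero => rw [elemSymm]; split_ifs <;> norm_num
  | succ n ih => exact add_nonneg (ih r) (mul_nonneg (ha n) (ih _))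

theorem stirlingFirst_eq_elemSymm (n k : ℕ) :
    (Nat.stirlingFirst n k : ℝ) = elemSymm (fun i => (i : ℝ)) n (n - k) := by
  induction n generalizing k with
  | zero => cases k <;> simp [elemSymm, Nat.stirlingFirst]; omega
  | succ n ih =>
    rw [elemSymm]
    cases k with
    | zero =>
      have h := ih 0
      rw [Nat.cast_zero, sub_zero] at h
      rw [elemSymm_of_lt _ (by push_cast; omega)]
      push_cast
      rw [sub_zero, add_sub_cancel_right, ← h]
      cases n <;> simp [Nat.stirlingFirst]
    | succ k =>
      rw [Nat.stirlingFirst_succ_succ]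
      push_cast
      rw [ih, ih, show (n : ℤ) + 1 - (k + 1) - 1 = n - (k + 1) by ring,
        show (n : ℤ) + 1 - (k + 1) = n - k by ring]
      push_cast
      ring

section Newton

variable {a : ℕ → ℝ}

theorem mul_elemSymm_le (ha : ∀ i, 0 ≤ a i) (n : ℕ) (r : ℤ) :
    r * elemSymm a n r ≤ (∑ i ∈ range n, a i) * elemSymm a n (r - 1) := by
  induction n generalizing r with
  | zero => by_cases h : r = 0 <;> simp [elemSymm, h]
  | succ n ih =>
    have h1 := ih r
    have h2 := mul_le_mul_of_nonneg_left (ih (r - 1)) (ha n)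
    have h3 := mul_nonneg (pow_nonneg (ha n) 2) (elemSymm_nonneg ha n (r - 1 - 1))
    rw [sum_range_succ, elemSymm, elemSymm]
    push_cast at h2
    linear_combination h1 + h2 + h3

theorem le_mul_elemSymm (ha : ∀ i, 0 ≤ a i) (n : ℕ) (r : ℤ) :
    (∑ i ∈ range n, a i) * elemSymm a n (r - 1) - (∑ i ∈ range n, a i ^ 2) * elemSymm a n (r - 2)
      ≤ r * elemSymm a n r := by
  induction n generalizing r with
  | zero => by_cases h : r = 0 <;> simp [elemSymm, h]
  | succ n ih =>
    have h1 := ih r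
    have h2 := mul_le_mul_of_nonneg_left (ih (r - 1)) (ha n)
    have h3 := mul_nonneg (pow_nonneg (ha n) 3) (elemSymm_nonneg ha n (r - 3))
    rw [sum_range_succ, sum_range_succ, elemSymm, elemSymm, elemSymm]
    rw [show r - 1 - 1 = r - 2 by ring, show r - 1 - 2 = r - 3 by ring] at *
    rw [show r - 2 - 1 = r - 3 by ring]
    push_cast at h2
    linear_combination h1 + h2 + h3

theorem mul_elemSymm_le_three_terms (ha : ∀ i, 0 ≤ a i) (n : ℕ) (r : ℤ) :
    r * elemSymm a n r ≤
      (∑ i ∈ range n, a i) * elemSymm a n (r - 1)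
        - (∑ i ∈ range n, a i ^ 2) * elemSymm a n (r - 2)
        + (∑ i ∈ range n, a i ^ 3) * elemSymm a n (r - 3) := by
  induction n generalizing r with
  | zero => by_cases h : r = 0 <;> simp [elemSymm, h]
  | succ n ih =>
    have h1 := ih r
    have h2 := mul_le_mul_of_nonneg_left (ih (r - 1)) (ha n)
    have h3 := mul_nonneg (pow_nonneg (ha n) 4) (elemSymm_nonneg ha n (r - 4))
    rw [sum_range_succ, sum_range_succ, sum_range_succ, elemSymm, elemSymm, elemSymm, elemSymm]
    rw [show r - 1 - 1 = r - 2 by ring, show r - 1 - 2 = r - 3 by ring,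
      show r - 1 - 3 = r - 4 by ring] at *
    rw [show r - 2 - 1 = r - 3 by ring, show r - 3 - 1 = r - 4 by ring]
    push_cast at h2
    linear_combination h1 + h2 + h3

end Newton

theorem abs_sub_exp_le_of_recurrence_s15 {P : ℕ → ℝ} {q B : ℝ} (hq : 0 ≤ q)
    (R : ℕ) (hR : R * q ≤ 1) (h0 : P 0 = 1)
    (hP : ∀ r < R, |P (r + 1) - (1 - r * q) * P r| ≤ B) :
    |P R - Real.exp (-(q * (R * (R - 1) / 2)))| ≤ R * (B + R ^ 2 * q ^ 2) := by
  suffices h : ∀ r ≤ R,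
      |P r - Real.exp (-(q * (r * (r - 1) / 2)))| ≤ r * (B + R ^ 2 * q ^ 2) from h R le_rfl
  intro r
  induction r with
  | zero => simp [h0]
  | succ r ih =>
    intro hr
    have hrR : (r : ℝ) ≤ R := by exact_mod_cast (Nat.le_succ r).trans hr
    have hx0 : 0 ≤ r * q := by positivity
    have hx1 : r * q ≤ 1 := (mul_le_mul_of_nonneg_right hrR hq).trans hR
    have h1 := ih (Nat.le_of_succ_le hr)
    have h2 := hP r hr
    set Q := Real.exp (-(q * (r * (r - 1) / 2))) with hQ
    have hQ1 : Q ≤ 1 := by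
      rw [hQ, Real.exp_le_one_iff]
      rcases Nat.eq_zero_or_pos r with rfl | h
      · simp
      · have : (1 : ℝ) ≤ r := by exact_mod_cast h
        have : 0 ≤ (r : ℝ) - 1 := by linarith
        have : 0 ≤ q * (r * (r - 1) / 2) := by positivity
        linarith
    have hQ' : Real.exp (-(q * ((r + 1 : ℕ) * ((r + 1 : ℕ) - 1) / 2))) =
        Q * Real.exp (-(r * q)) := by
      rw [hQ, ← Real.exp_add]
      congr 1
      push_cast
      ring
    have h3 : |Real.exp (-(r * q)) - 1 - -(r * q)| ≤ (-(r * q)) ^ 2 :=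
      Real.abs_exp_sub_one_sub_id_le (by rw [abs_neg, abs_of_nonneg hx0]; exact hx1)
    have h4 : (r * q) ^ 2 ≤ R ^ 2 * q ^ 2 := by rw [mul_pow]; gcongr
    have hsplit : P (r + 1) - Q * Real.exp (-(r * q)) =
        (P (r + 1) - (1 - r * q) * P r) + (1 - r * q) * (P r - Q)
          + -(Q * (Real.exp (-(r * q)) - 1 - -(r * q))) := by ring
    rw [hQ', hsplit]
    refine (abs_add_three _ _ _).trans ?_
    have h5 : |(1 - r * q) * (P r - Q)| ≤ r * (B + R ^ 2 * q ^ 2) := by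
      rw [abs_mul, abs_of_nonneg (by linarith)]
      exact (mul_le_of_le_one_left (abs_nonneg _) (by linarith)).trans h1
    have h6 : |-(Q * (Real.exp (-(r * q)) - 1 - -(r * q)))| ≤ R ^ 2 * q ^ 2 := by
      rw [abs_neg, abs_mul, abs_of_nonneg (Real.exp_pos _).le]
      refine (mul_le_of_le_one_left (abs_nonneg _) hQ1).trans (h3.trans ?_)
      rw [neg_sq]
      exact h4
    push_cast
    linarith

/-- The probability that `r` independent samples, drawn with probabilities proportional to the
weights `a 0, …, a (n - 1)`, are pairwise distinct. -/
noncomputable def distinctProb (a : ℕ → ℝ) (n r : ℕ) : ℝ :=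
  r.factorial * elemSymm a n r / (∑ i ∈ range n, a i) ^ r

section DistinctProb

variable {a : ℕ → ℝ} {n : ℕ}

theorem distinctProb_zero : distinctProb a n 0 = 1 := by
  simp [distinctProb, elemSymm_zero_right]

theorem distinctProb_succ_le (ha : ∀ i, 0 ≤ a i) (hp : 0 < ∑ i ∈ range n, a i) (r : ℕ) :
    distinctProb a n (r + 1) ≤ distinctProb a n r := by
  have h := mul_elemSymm_le ha n (r + 1 : ℕ)
  rw [show ((r + 1 : ℕ) : ℤ) - 1 = r by push_cast; ring] at h
  have hf := mul_le_mul_of_nonneg_left h (Nat.cast_nonneg' (α := ℝ) r.factorial)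
  rw [distinctProb, distinctProb, div_le_div_iff₀ (by positivity) (by positivity),
    Nat.factorial_succ, pow_succ]
  have := mul_le_mul_of_nonneg_right hf (pow_nonneg hp.le r)
  push_cast at this ⊢
  linarith

theorem le_distinctProb (ha : ∀ i, 0 ≤ a i) (hp : 0 < ∑ i ∈ range n, a i) (r : ℕ) :
    distinctProb a n (r + 1) - (r + 1) *
      ((∑ i ∈ range n, a i ^ 2) / (∑ i ∈ range n, a i) ^ 2) * distinctProb a n r ≤
      distinctProb a n (r + 2) := by
  have h := le_mul_elemSymm ha n (r + 2 : ℕ)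
  rw [show ((r + 2 : ℕ) : ℤ) - 1 = (r + 1 : ℕ) by push_cast; ring,
    show ((r + 2 : ℕ) : ℤ) - 2 = r by push_cast; ring] at h
  have hf := mul_le_mul_of_nonneg_left h (Nat.cast_nonneg' (α := ℝ) (r + 1).factorial)
  have := div_le_div_of_nonneg_right hf (pow_nonneg hp.le (r + 2))
  simp only [distinctProb]
  refine le_of_eq_of_le ?_ (this.trans_eq ?_)
  · rw [Nat.factorial_succ]
    push_cast
    field_simp
    ring
  · rw [Nat.factorial_succ (r + 1)]
    push_cast
    ring

theorem distinctProb_le (ha : ∀ i, 0 ≤ a i) (hp : 0 < ∑ i ∈ range n, a i) (r : ℕ) :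
    distinctProb a n (r + 3) ≤ distinctProb a n (r + 2) - (r + 2) *
      ((∑ i ∈ range n, a i ^ 2) / (∑ i ∈ range n, a i) ^ 2) * distinctProb a n (r + 1)
      + (r + 2) * (r + 1) *
        ((∑ i ∈ range n, a i ^ 3) / (∑ i ∈ range n, a i) ^ 3) * distinctProb a n r := by
  have h := mul_elemSymm_le_three_terms ha n (r + 3 : ℕ)
  rw [show ((r + 3 : ℕ) : ℤ) - 1 = (r + 2 : ℕ) by push_cast; ring,
    show ((r + 3 : ℕ) : ℤ) - 2 = (r + 1 : ℕ) by push_cast; ring,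
    show ((r + 3 : ℕ) : ℤ) - 3 = r by push_cast; ring] at h
  have hf := mul_le_mul_of_nonneg_left h (Nat.cast_nonneg' (α := ℝ) (r + 2).factorial)
  have := div_le_div_of_nonneg_right hf (pow_nonneg hp.le (r + 3))
  simp only [distinctProb]
  refine le_of_eq_of_le ?_ (this.trans_eq ?_)
  · rw [Nat.factorial_succ (r + 2)]
    push_cast
    ring
  · rw [Nat.factorial_succ (r + 1), Nat.factorial_succ]
    push_cast
    field_simp
    ring

theorem distinctProb_one (ha : ∀ i, 0 ≤ a i) (hp : 0 < ∑ i ∈ range n, a i) :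
    distinctProb a n 1 = 1 := by
  have h1 := mul_elemSymm_le ha n 1
  have h2 := le_mul_elemSymm ha n 1
  rw [elemSymm_of_neg a n (show (1 : ℤ) - 2 < 0 by norm_num)] at h2
  simp only [sub_self, elemSymm_zero_right, Int.cast_one, one_mul, mul_one, mul_zero,
    sub_zero] at h1 h2
  rw [distinctProb, Nat.cast_one, le_antisymm h1 h2]
  simp [hp.ne']

theorem distinctProb_two_le (ha : ∀ i, 0 ≤ a i) (hp : 0 < ∑ i ∈ range n, a i) :
    distinctProb a n 2 ≤ 1 - (∑ i ∈ range n, a i ^ 2) / (∑ i ∈ range n, a i) ^ 2 := by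
  have h1 := mul_elemSymm_le ha n 1
  have h2 := mul_elemSymm_le_three_terms ha n 2
  rw [elemSymm_of_neg a n (show (2 : ℤ) - 3 < 0 by norm_num)] at h2
  simp only [sub_self, elemSymm_zero_right, Int.cast_one, one_mul, mul_one, mul_zero, add_zero,
    Int.cast_ofNat, show (2 : ℤ) - 1 = 1 by norm_num] at h1 h2
  have h3 := mul_le_mul_of_nonneg_left h1 hp.le
  rw [distinctProb, one_sub_div (by positivity)]
  gcongr
  norm_num
  linarith

theorem distinctProb_le_one (ha : ∀ i, 0 ≤ a i) (hp : 0 < ∑ i ∈ range n, a i) (r : ℕ) :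
    distinctProb a n r ≤ 1 := by
  rw [← distinctProb_zero (a := a) (n := n)]
  exact antitone_nat_of_succ_le (distinctProb_succ_le ha hp) (Nat.zero_le r)

theorem abs_distinctProb_succ_sub_le (ha : ∀ i, 0 ≤ a i) (hp : 0 < ∑ i ∈ range n, a i) {q s : ℝ}
    (hq : q = (∑ i ∈ range n, a i ^ 2) / (∑ i ∈ range n, a i) ^ 2)
    (hs : s = (∑ i ∈ range n, a i ^ 3) / (∑ i ∈ range n, a i) ^ 3) (r : ℕ) :
    |distinctProb a n (r + 1) - (1 - r * q) * distinctProb a n r| ≤ r ^ 2 * (q ^ 2 + s) := by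
  have hq0 : 0 ≤ q := hq ▸ div_nonneg (sum_nonneg fun i _ => by positivity) (by positivity)
  have hs0 : 0 ≤ s := hs ▸ div_nonneg (sum_nonneg fun i _ => pow_nonneg (ha i) 3) (by positivity)
  match r with
  | 0 => simp [distinctProb_one ha hp, distinctProb_zero]
  | 1 =>
    have h1 := le_distinctProb ha hp 0
    have h2 := distinctProb_two_le ha hp
    rw [← hq] at h1 h2
    simp only [Nat.cast_zero, zero_add, distinctProb_one ha hp, distinctProb_zero] at h1
    simp only [Nat.reduceAdd, Nat.cast_one, distinctProb_one ha hp]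
    rw [show distinctProb a n 2 - (1 - 1 * q) * 1 = 0 by linarith, abs_zero]
    positivity
  | r + 2 =>
    have hlow := le_distinctProb ha hp (r + 1)
    have hlow' := le_distinctProb ha hp r
    have hup := distinctProb_le ha hp r
    have hanti := distinctProb_succ_le ha hp (r + 1)
    have h1 := distinctProb_le_one ha hp r
    rw [← hq] at hlow hlow' hup
    rw [← hs] at hup
    simp only [add_assoc, Nat.reduceAdd] at *
    push_cast at *
    generalize distinctProb a n r = x at *
    generalize distinctProb a n (r + 1) = y at *
    generalize distinctProb a n (r + 2) = z at *
    generalize distinctProb a n (r + 3) = w at *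
    have hr : (0 : ℝ) ≤ r := Nat.cast_nonneg r
    generalize (r : ℝ) = r at *
    have hrr : (r + 2) * (r + 1) ≤ (r + 2) ^ 2 := by nlinarith
    rw [abs_le]
    constructor
    · have e1 : (r + 2) * q * y ≤ (r + 2) * q * (z + (r + 1) * q) := by
        gcongr
        have : (r + 1) * q * x ≤ (r + 1) * q := mul_le_of_le_one_right (by positivity) h1
        linarith
      have e2 : (r + 2) * (r + 1) * q ^ 2 ≤ (r + 2) ^ 2 * q ^ 2 := by gcongr
      have e3 : 0 ≤ (r + 2) ^ 2 * s := by positivity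
      linarith
    · have e1 : (r + 2) * q * z ≤ (r + 2) * q * y := by gcongr
      have e2 : (r + 2) * (r + 1) * s * x ≤ (r + 2) ^ 2 * s :=
        (mul_le_of_le_one_right (by positivity) h1).trans (by gcongr)
      have e3 : 0 ≤ (r + 2) ^ 2 * q ^ 2 := by positivity
      linarith

/-- The birthday approximation, with an explicit error term. -/
theorem abs_distinctProb_sub_exp_le (ha : ∀ i, 0 ≤ a i) (hp : 0 < ∑ i ∈ range n, a i) {q s : ℝ}
    (hq : q = (∑ i ∈ range n, a i ^ 2) / (∑ i ∈ range n, a i) ^ 2)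
    (hs : s = (∑ i ∈ range n, a i ^ 3) / (∑ i ∈ range n, a i) ^ 3) {R : ℕ} (hR : R * q ≤ 1) :
    |distinctProb a n R - Real.exp (-(q * (R * (R - 1) / 2)))| ≤ R ^ 3 * (2 * q ^ 2 + s) := by
  have hq0 : 0 ≤ q := hq ▸ div_nonneg (sum_nonneg fun i _ => by positivity) (by positivity)
  have hs0 : 0 ≤ s := hs ▸ div_nonneg (sum_nonneg fun i _ => pow_nonneg (ha i) 3) (by positivity)
  have h := abs_sub_exp_le_of_recurrence_s15 (B := R ^ 2 * (q ^ 2 + s)) hq0 R hR distinctProb_zero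
    fun r hr => (abs_distinctProb_succ_sub_le ha hp hq hs r).trans <| by gcongr
  exact h.trans_eq (by ring)

end DistinctProb

theorem sum_range_natCast (n : ℕ) : ∑ i ∈ range n, (i : ℝ) = n * (n - 1) / 2 := by
  induction n with
  | zero => simp
  | succ n ih => rw [sum_range_succ, ih]; push_cast; ring

theorem sum_range_natCast_sq (n : ℕ) :
    ∑ i ∈ range n, (i : ℝ) ^ 2 = n * (n - 1) * (2 * n - 1) / 6 := by
  induction n with
  | zero => simp
  | succ n ih => rw [sum_range_succ, ih]; push_cast; ring

theorem sum_range_natCast_cube (n : ℕ) :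
    ∑ i ∈ range n, (i : ℝ) ^ 3 = (n * (n - 1) / 2) ^ 2 := by
  induction n with
  | zero => simp
  | succ n ih => rw [sum_range_succ, ih]; push_cast; ring

theorem stirling1_div_eq_distinctProb {n k : ℕ} (hk : k ≤ n) :
    (stirling1 n k : ℝ) / (1 / ((n - k).factorial : ℝ) * (n.choose 2 : ℝ) ^ (n - k)) =
      distinctProb (fun i => (i : ℝ)) n (n - k) := by
  rw [distinctProb, sum_range_natCast, ← Nat.cast_choose_two ℝ n, stirling1_eq_stirlingFirst,
    stirlingFirst_eq_elemSymm, Nat.cast_sub hk]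
  field_simp

theorem tendsto_distinctProb {t : ℝ} {R : ℕ → ℕ}
    (hR : Tendsto (fun n : ℕ => (R n : ℝ) / Real.sqrt n) atTop (nhds t)) :
    Tendsto (fun n => distinctProb (fun i => (i : ℝ)) n (R n)) atTop
      (nhds (Real.exp (-(2 / 3) * t ^ 2))) := by
  set q : ℕ → ℝ := fun n =>
    (∑ i ∈ range n, (i : ℝ) ^ 2) / (∑ i ∈ range n, (i : ℝ)) ^ 2 with hq
  set s : ℕ → ℝ := fun n =>
    (∑ i ∈ range n, (i : ℝ) ^ 3) / (∑ i ∈ range n, (i : ℝ)) ^ 3 with hs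
  have hinv : Tendsto (fun n : ℕ => (n : ℝ)⁻¹) atTop (nhds 0) := tendsto_inv_atTop_nhds_zero_nat
  have hsqrt : Tendsto (fun n : ℕ => (Real.sqrt n)⁻¹) atTop (nhds 0) :=
    tendsto_inv_atTop_zero.comp (Real.tendsto_sqrt_atTop.comp tendsto_natCast_atTop_atTop)
  have hnq : Tendsto (fun n : ℕ => n * q n) atTop (nhds (4 / 3)) := by
    have h : Tendsto (fun n : ℕ => (4 - 2 * (n : ℝ)⁻¹) / (3 * (1 - (n : ℝ)⁻¹))) atTop
        (nhds ((4 - 2 * 0) / (3 * (1 - 0)))) :=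
      ((hinv.const_mul 2).const_sub 4).div ((hinv.const_sub 1).const_mul 3) (by norm_num)
    norm_num at h
    refine h.congr' ?_
    filter_upwards [eventually_ge_atTop 2] with n hn
    have hn' : (2 : ℝ) ≤ n := by exact_mod_cast hn
    have h1 : (n : ℝ) ≠ 0 := by positivity
    have h2 : (n : ℝ) - 1 ≠ 0 := by linarith
    simp only [hq]
    rw [sum_range_natCast, sum_range_natCast_sq]
    field_simp
    ring
  have hns : Tendsto (fun n : ℕ => (n : ℝ) ^ 2 * s n) atTop (nhds 2) := by
    have h : Tendsto (fun n : ℕ => 2 / (1 - (n : ℝ)⁻¹)) atTop (nhds (2 / (1 - 0))) :=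
      tendsto_const_nhds.div (hinv.const_sub 1) (by norm_num)
    norm_num at h
    refine h.congr' ?_
    filter_upwards [eventually_ge_atTop 2] with n hn
    have hn' : (2 : ℝ) ≤ n := by exact_mod_cast hn
    have h1 : (n : ℝ) ≠ 0 := by positivity
    have h2 : (n : ℝ) - 1 ≠ 0 := by linarith
    simp only [hs]
    rw [sum_range_natCast, sum_range_natCast_cube]
    field_simp
  have hsq : ∀ {n : ℕ}, 0 < n → 0 < Real.sqrt n ∧ Real.sqrt n * Real.sqrt n = n := fun {n} hn =>
    ⟨Real.sqrt_pos.2 (by exact_mod_cast hn), Real.mul_self_sqrt (Nat.cast_nonneg n)⟩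
  have hRq : Tendsto (fun n => R n * q n) atTop (nhds 0) := by
    have h := (hR.mul hnq).mul hsqrt
    rw [mul_zero] at h
    refine h.congr' ?_
    filter_upwards [eventually_gt_atTop 0] with n hn
    obtain ⟨h1, h2⟩ := hsq hn
    nth_rewrite 2 [← h2]
    field_simp
  have herr : Tendsto (fun n => (R n : ℝ) ^ 3 * (2 * q n ^ 2 + s n)) atTop (nhds 0) := by
    have h := ((hR.pow 3).mul (((hnq.pow 2).const_mul 2).add hns)).mul hsqrt
    rw [mul_zero] at h
    refine h.congr' ?_
    filter_upwards [eventually_gt_atTop 0] with n hn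
    obtain ⟨h1, h2⟩ := hsq hn
    generalize Real.sqrt n = w at h1 h2 ⊢
    rw [← h2]
    field_simp
  have hexp : Tendsto (fun n => -(q n * (R n * (R n - 1) / 2))) atTop
      (nhds (-(2 / 3) * t ^ 2)) := by
    have h := (((hnq.mul (hR.pow 2)).sub ((hnq.mul hR).mul hsqrt)).div_const 2).neg
    rw [show -((4 / 3 * t ^ 2 - 4 / 3 * t * 0) / 2) = -(2 / 3) * t ^ 2 by ring] at h
    refine h.congr' ?_
    filter_upwards [eventually_gt_atTop 0] with n hn
    obtain ⟨h1, h2⟩ := hsq hn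
    nth_rewrite 1 3 [← h2]
    field_simp
  have hdiff : Tendsto (fun n => distinctProb (fun i => (i : ℝ)) n (R n) -
      Real.exp (-(q n * (R n * (R n - 1) / 2)))) atTop (nhds 0) := by
    refine squeeze_zero_norm' ?_ herr
    filter_upwards [eventually_ge_atTop 2, hRq.eventually_le_const one_pos] with n hn hle
    have hn' : (2 : ℝ) ≤ n := by exact_mod_cast hn
    refine abs_distinctProb_sub_exp_le (fun i => Nat.cast_nonneg i) ?_ rfl rfl hle
    rw [sum_range_natCast]
    have : 0 < (n : ℝ) - 1 := by linarith
    positivity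
  simpa using hdiff.add ((Real.continuous_exp.tendsto _).comp hexp)

/-- if `k(n)` is a sequence of positive integers with `(n − k(n))/√n → t > 0`,
and `r = n − k(n)`, then `s(n, k(n)) ~ (1/r!)·C(n,2)^r·exp(−(2/3)t²)`, i.e. the ratio of the
two sides tends to `1` as `n → ∞`. -/
theorem stirling_first_kind_asymptotics (t : ℝ) (ht : 0 < t) (k : ℕ → ℕ)
    (hpos : ∀ n, 0 < k n)
    (hlim : Tendsto (fun n : ℕ => ((n - k n : ℕ) : ℝ) / Real.sqrt n) atTop (nhds t)) :
    Tendsto (fun n : ℕ => (stirling1 n (k n) : ℝ) /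
        (1 / ((n - k n).factorial : ℝ) * (n.choose 2 : ℝ) ^ (n - k n) *
          Real.exp (-(2/3) * t ^ 2)))
      atTop (nhds 1) := by
  have h := (tendsto_distinctProb hlim).div_const (Real.exp (-(2/3) * t ^ 2))
  rw [div_self (Real.exp_pos _).ne'] at h
  refine h.congr' ?_
  filter_upwards [hlim.eventually_const_lt ht] with n hn
  have hk : k n ≤ n := by
    by_contra hlt
    rw [Nat.sub_eq_zero_of_le (not_le.1 hlt).le] at hn
    simp at hn
  rw [← stirling1_div_eq_distinctProb hk, div_div]
end
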